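/- arXiv:1906.11236 — 4 statements merged into one kernel-verified Lean document; each statement's English description precedes it below -/
import Mathlib

section
/- Skew fibrations between cographs compose: if G, H, K are finite cographs and f : G → H and g : H → K are skew fibrations, then the composite g ∘ f : G → K is a skew fibration. -/
/-- A simple graph is `P4`-free if no four (distinct) vertices induce a subgraph
isomorphic to the path on four vertices with three edges. -/
def IsP4Free {V : Type*} (G : SimpleGraph V) : Prop :=
  ¬ ∃ a b c d : V, a ≠ b ∧ a ≠ c ∧ a ≠ d ∧ b ≠ c ∧ b ≠ d ∧ c ≠ d ∧
      G.Adj a b ∧ G.Adj b c ∧ G.Adj c d ∧ ¬ G.Adj a c ∧ ¬ G.Adj a d ∧ ¬ G.Adj b d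

/-- A graph homomorphism `f : G → H` is a *skew fibration* if for every vertex `v` of `G`
and every vertex `w` of `H` adjacent to `f v`, there exists a vertex `w'` adjacent to `v`
in `G` such that `f w'` is not adjacent to `w` in `H`. -/
def IsSkewFibration {V W : Type*} (G : SimpleGraph V) (H : SimpleGraph W) (f : G →g H) : Prop :=
  ∀ v : V, ∀ w : W, H.Adj w (f v) → ∃ w' : V, G.Adj w' v ∧ ¬ H.Adj (f w') w

/-- `G` has no edge between some nonempty proper subset of `S` and its complement in `S`. -/
def SplitsOn {V : Type*} (G : SimpleGraph V) (S : Finset V) : Prop :=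
  ∃ A : Finset V, A.Nonempty ∧ A ⊂ S ∧ ∀ a ∈ A, ∀ b ∈ S, b ∉ A → ¬ G.Adj a b

theorem IsP4Free.adj_of_path {V : Type*} {G : SimpleGraph V} (hG : IsP4Free G) {a b c d : V}
    (hab : G.Adj a b) (hbc : G.Adj b c) (hcd : G.Adj c d) (hac : ¬ G.Adj a c)
    (had : ¬ G.Adj a d) : G.Adj b d := by
  by_contra hbd
  refine hG ⟨a, b, c, d, hab.ne, ?_, ?_, hbc.ne, ?_, hcd.ne, hab, hbc, hcd, hac, had, hbd⟩
  · rintro rfl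
    exact had hcd
  · rintro rfl
    exact hac hcd.symm
  · rintro rfl
    exact had hab

theorem IsP4Free.compl {V : Type*} {G : SimpleGraph V} (hG : IsP4Free G) : IsP4Free Gᶜ := by
  rintro ⟨a, b, c, d, hab, hac, had, hbc, hbd, hcd, h1, h2, h3, h4, h5, h6⟩
  simp only [SimpleGraph.compl_adj, not_and, not_not] at h1 h2 h3 h4 h5 h6
  exact h1.2 (hG.adj_of_path (h4 hac).symm (h5 had) (h6 hbd).symm (h3.2 ·) (h2.2 ·.symm))

theorem SplitsOn.insert {V : Type*} [DecidableEq V] {G : SimpleGraph V} (hG : IsP4Free G)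
    {S : Finset V} {v : V} (hv : v ∉ S) (h : SplitsOn G S) :
    SplitsOn G (insert v S) ∨ SplitsOn Gᶜ (insert v S) := by
  classical
  by_cases hall : ∀ u ∈ S, G.Adj v u
  · obtain ⟨A, ⟨a, ha⟩, hAS, -⟩ := h
    refine Or.inr ⟨{v}, by simp, ?_, ?_⟩
    · rw [Finset.ssubset_iff_of_subset (by simp)]
      exact ⟨a, by simp [hAS.1 ha], by rintro h; simp at h; exact hv (h ▸ hAS.1 ha)⟩
    · simp only [Finset.mem_singleton, Finset.mem_insert, SimpleGraph.compl_adj]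
      rintro a rfl b (rfl | hb) hne ⟨-, h⟩
      · exact hne rfl
      · exact h (hall b hb)
  push Not at hall
  obtain ⟨u, huS, hu⟩ := hall
  left
  -- a closed proper subset of `S` containing `u`, of least cardinality
  have hex : ∃ A : Finset V, u ∈ A ∧ A ⊂ S ∧ ∀ a ∈ A, ∀ b ∈ S, b ∉ A → ¬ G.Adj a b := by
    obtain ⟨A, ⟨a, ha⟩, hAS, hA⟩ := h
    by_cases huA : u ∈ A
    · exact ⟨A, huA, hAS, hA⟩
    · refine ⟨S \ A, by simp [huS, huA], ?_, ?_⟩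
      · rw [Finset.ssubset_iff_of_subset Finset.sdiff_subset]
        exact ⟨a, hAS.1 ha, by simp [ha]⟩
      · intro x hx b hb hbA hxb
        simp only [Finset.mem_sdiff, not_and, not_not] at hx hbA
        exact hA b (hbA hb) x hx.1 hx.2 hxb.symm
  obtain ⟨A, ⟨huA, hAS, hA⟩, hmin⟩ := WellFounded.has_min
    (measure (Finset.card (α := V))).wf
    {A | u ∈ A ∧ A ⊂ S ∧ ∀ a ∈ A, ∀ b ∈ S, b ∉ A → ¬ G.Adj a b} hex
  by_cases hvA : ∀ a ∈ A, ¬ G.Adj v a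
  · refine ⟨A, ⟨u, huA⟩, hAS.trans_subset (Finset.subset_insert _ _), ?_⟩
    intro a ha b hb hbA hab
    rcases Finset.mem_insert.1 hb with rfl | hb
    · exact hvA a ha hab.symm
    · exact hA a ha b hb hbA hab
  push Not at hvA
  obtain ⟨n, hnA, hn⟩ := hvA
  have hcross : ∃ x ∈ A, ∃ y ∈ A, ¬ G.Adj v x ∧ G.Adj v y ∧ G.Adj x y := by
    by_contra! hno
    have hss : A.filter (fun x => ¬ G.Adj v x) ⊂ A := by
      rw [Finset.ssubset_iff_of_subset (Finset.filter_subset _ _)]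
      exact ⟨n, hnA, by simp [hn]⟩
    refine hmin (A.filter fun x => ¬ G.Adj v x) ⟨by simp [huA, hu], hss.trans hAS, ?_⟩
      (Finset.card_lt_card hss)
    intro a ha b hb hbA hab
    simp only [Finset.mem_filter, not_and, not_not] at ha hbA
    by_cases hb' : b ∈ A
    · exact hno a ha.1 b hb' ha.2 (hbA hb') hab
    · exact hA a ha.1 b hb hb' hab
  obtain ⟨x, hx, y, hy, hvx, hvy, hxy⟩ := hcross
  obtain ⟨s, hs, hsA⟩ := Finset.exists_of_ssubset hAS
  refine ⟨S \ A, ⟨s, by simp [hs, hsA]⟩, ?_, ?_⟩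
  · rw [Finset.ssubset_iff_of_subset (Finset.sdiff_subset.trans (Finset.subset_insert _ _))]
    exact ⟨v, by simp, by simp [hv]⟩
  · intro b hb a ha haA hba
    simp only [Finset.mem_sdiff, not_and, not_not] at hb haA
    rcases Finset.mem_insert.1 ha with rfl | ha
    · exact hA y hy b hb.1 hb.2
        (hG.adj_of_path hxy hvy.symm hba.symm (hvx ·.symm) (hA x hx b hb.1 hb.2))
    · exact hA a (haA ha) b hb.1 hb.2 hba.symm

theorem IsP4Free.splitsOn_or_compl {V : Type*} {G : SimpleGraph V} (hG : IsP4Free G)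
    (S : Finset V) (hS : S.Nontrivial) : SplitsOn G S ∨ SplitsOn Gᶜ S := by
  classical
  induction S using Finset.induction_on with
  | empty => simp at hS
  | insert v S hv ih =>
    by_cases hS' : S.Nontrivial
    · rcases ih hS' with h | h
      · exact h.insert hG hv
      · simpa [or_comm] using h.insert hG.compl hv
    · have hne : S.Nonempty := by
        rw [Finset.nonempty_iff_ne_empty]
        rintro rfl
        simp at hS
      obtain ⟨x, rfl⟩ | h := hne.exists_eq_singleton_or_nontrivial
      · have hvx : v ≠ x := by simpa using hv
        have hss : ({v} : Finset V) ⊂ {v, x} := by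
          rw [Finset.ssubset_iff_of_subset (by simp)]
          exact ⟨x, by simp, by simpa using hvx.symm⟩
        by_cases h : G.Adj v x
        · refine Or.inr ⟨{v}, by simp, hss, ?_⟩
          simp [h]
        · refine Or.inl ⟨{v}, by simp, hss, ?_⟩
          simp [h]
      · exact absurd h hS'

/-- A skew fibration between cographs, here relative to `S` and `T`, sends maximal cliques to
maximal cliques. -/
theorem IsP4Free.exists_not_adj_map_of_maximal_clique {U V : Type*}
    {G : SimpleGraph U} {H : SimpleGraph V}
    (hG : IsP4Free G) (hH : IsP4Free H) (f : G →g H) (S : Finset U) (T : Set V) (C : Set U)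
    (hne : S.Nonempty) (hmap : ∀ a ∈ S, f a ∈ T)
    (hskew : ∀ v ∈ S, ∀ w ∈ T, H.Adj w (f v) → ∃ w' ∈ S, G.Adj w' v ∧ ¬ H.Adj (f w') w)
    (hCS : ∀ c ∈ C, c ∈ S) (hC : G.IsClique C) (hmax : ∀ x ∈ S, ∃ c ∈ C, ¬ G.Adj c x)
    (w : V) (hw : w ∈ T) : ∃ c ∈ C, ¬ H.Adj w (f c) := by
  classical
  induction S using Finset.strongInduction generalizing T C w with
  | H S ih =>
  by_contra! hwC
  obtain ⟨s, hs⟩ := hne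
  obtain ⟨c₀, hc₀, -⟩ := hmax s hs
  have hSnt : S.Nontrivial := by
    obtain ⟨w', hw', hadj, -⟩ := hskew c₀ (hCS _ hc₀) w hw (hwC _ hc₀)
    exact ⟨w', hw', c₀, hCS _ hc₀, hadj.ne⟩
  rcases hG.splitsOn_or_compl S hSnt with ⟨A, ⟨a, ha⟩, hAS, hA⟩ | ⟨A, ⟨a, ha⟩, hAS, hA⟩
  · obtain ⟨B, hB, hcB, hBc⟩ : ∃ B : Finset U, B ⊂ S ∧ c₀ ∈ B ∧
        ∀ x ∈ B, ∀ y ∈ S, y ∉ B → ¬ G.Adj x y := by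
      by_cases h : c₀ ∈ A
      · exact ⟨A, hAS, h, hA⟩
      · refine ⟨S \ A, ?_, by simp [h, hCS _ hc₀], ?_⟩
        · rw [Finset.ssubset_iff_of_subset Finset.sdiff_subset]
          exact ⟨a, hAS.1 ha, by simp [ha]⟩
        · intro x hx b hb hbA hxb
          simp only [Finset.mem_sdiff, not_and, not_not] at hx hbA
          exact hA b (hbA hb) x hx.1 hx.2 hxb.symm
    obtain ⟨c, hc, hwc⟩ := ih B hB T C ⟨c₀, hcB⟩ (fun x hx => hmap x (hB.1 hx))
      (fun v hv w hw h => by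
        obtain ⟨w', hw', hadj, hn⟩ := hskew v (hB.1 hv) w hw h
        exact ⟨w', by_contra fun hb => hBc v hv w' hw' hb hadj.symm, hadj, hn⟩)
      (fun c hc => by
        by_contra hcn
        exact hBc c₀ hcB c (hCS c hc) hcn (hC hc₀ hc fun h => hcn (h ▸ hcB)))
      hC (fun x hx => hmax x (hB.1 hx)) w hw
    exact hwc (hwC c hc)
  · have hadj : ∀ x ∈ A, ∀ y ∈ S, y ∉ A → G.Adj x y := by
      intro x hx y hy hyA
      by_contra h
      exact hA x hx y hy hyA ((SimpleGraph.compl_adj _ _ _).2 ⟨fun e => hyA (e ▸ hx), h⟩)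
    obtain ⟨b, hbS, hbA⟩ := Finset.exists_of_ssubset hAS
    -- each side of a join satisfies the hypotheses with respect to the common neighbours of
    -- the image of the other side
    have key : ∀ B D : Finset U, B ⊂ S → B.Nonempty → (∀ x ∈ S, x ∈ B ∨ x ∈ D) →
        (∀ x ∈ B, ∀ y ∈ D, G.Adj x y) →
        ∀ w ∈ T, (∀ y ∈ D, H.Adj w (f y)) → ∃ c ∈ C, c ∈ B ∧ ¬ H.Adj w (f c) := by
      intro B D hB hBne hcov hBD w hwT hwD
      obtain ⟨c, hc, h⟩ := ih B hB {w | w ∈ T ∧ ∀ y ∈ D, H.Adj w (f y)} {c | c ∈ C ∧ c ∈ B}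
        hBne (fun x hx => ⟨hmap x (hB.1 hx), fun y hy => f.map_adj (hBD x hx y hy)⟩)
        (fun v hv w hw h => by
          obtain ⟨w', hw', hadj, hn⟩ := hskew v (hB.1 hv) w hw.1 h
          refine ⟨w', (hcov w' hw').resolve_right fun hd => hn (hw.2 w' hd).symm, hadj, hn⟩)
        (fun c hc => hc.2) (hC.subset fun c hc => hc.1)
        (fun x hx => by
          obtain ⟨c, hc, hcx⟩ := hmax x (hB.1 hx)
          exact ⟨c, ⟨hc, (hcov c (hCS c hc)).resolve_right fun hd =>
            hcx (hBD x hx c hd).symm⟩, hcx⟩)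
        w ⟨hwT, hwD⟩
      exact ⟨c, hc.1, hc.2, h⟩
    have hBS : S \ A ⊂ S := by
      rw [Finset.ssubset_iff_of_subset Finset.sdiff_subset]
      exact ⟨a, hAS.1 ha, by simp [ha]⟩
    have keyA := key A (S \ A) hAS ⟨a, ha⟩
      (fun x hx => by by_cases h : x ∈ A <;> simp [h, hx])
      (fun x hx y hy => hadj x hx y (Finset.mem_sdiff.1 hy).1 (Finset.mem_sdiff.1 hy).2)
    have keyB := key (S \ A) A hBS ⟨b, by simp [hbS, hbA]⟩
      (fun x hx => by by_cases h : x ∈ A <;> simp [h, hx])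
      (fun x hx y hy => (hadj y hy x (Finset.mem_sdiff.1 hx).1 (Finset.mem_sdiff.1 hx).2).symm)
    have hx : ∃ x ∈ A, ¬ H.Adj w (f x) := by
      by_contra! h
      obtain ⟨c, hc, -, hn⟩ := keyB w hw h
      exact hn (hwC c hc)
    have hy : ∃ y ∈ S \ A, ¬ H.Adj w (f y) := by
      by_contra! h
      obtain ⟨c, hc, -, hn⟩ := keyA w hw h
      exact hn (hwC c hc)
    obtain ⟨x, hxA, hwx⟩ := hx
    obtain ⟨y, hyA, hwy⟩ := hy
    have hy' := Finset.mem_sdiff.1 hyA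
    obtain ⟨c, hc, hcA, hn⟩ := keyA (f x) (hmap x (hAS.1 hxA)) fun z hz =>
      f.map_adj (hadj x hxA z (Finset.mem_sdiff.1 hz).1 (Finset.mem_sdiff.1 hz).2)
    exact hn (hH.adj_of_path (hwC c hc) (f.map_adj (hadj c hcA y hy'.1 hy'.2))
      (f.map_adj (hadj x hxA y hy'.1 hy'.2)).symm hwy hwx).symm

theorem IsSkewFibration.exists_not_adj_of_maximal_clique {U V : Type*} [Fintype U]
    {G : SimpleGraph U} {H : SimpleGraph V} (hG : IsP4Free G) (hH : IsP4Free H) {f : G →g H}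
    (hf : IsSkewFibration G H f) {C : Set U} (hne : C.Nonempty) (hC : G.IsClique C)
    (hmax : ∀ x, ∃ c ∈ C, ¬ G.Adj c x) (w : V) : ∃ c ∈ f '' C, ¬ H.Adj c w := by
  obtain ⟨c, hc, h⟩ := hG.exists_not_adj_map_of_maximal_clique hH f Finset.univ Set.univ C
    ⟨hne.some, Finset.mem_univ _⟩ (by simp) (by simpa using fun v w => hf v w) (by simp) hC
    (fun x _ => hmax x) w trivial
  exact ⟨f c, ⟨c, hc, rfl⟩, fun h' => h h'.symm⟩

theorem SimpleGraph.Hom.isClique_image {U V : Type*} {G : SimpleGraph U} {H : SimpleGraph V}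
    (f : G →g H) {C : Set U} (hC : G.IsClique C) : H.IsClique (f '' C) := by
  rintro _ ⟨a, ha, rfl⟩ _ ⟨b, hb, rfl⟩ hne
  exact f.map_adj (hC ha hb fun h => hne (h ▸ rfl))

/-- Skew fibrations between finite cographs compose. -/
theorem isSkewFibration_comp {U V W : Type*} [Fintype U] [Fintype V] [Fintype W]
    (G : SimpleGraph U) (H : SimpleGraph V) (K : SimpleGraph W)
    (hG : IsP4Free G) (hH : IsP4Free H) (hK : IsP4Free K)
    (f : G →g H) (g : H →g K)
    (hf : IsSkewFibration G H f) (hg : IsSkewFibration H K g) :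
    IsSkewFibration G K (g.comp f) := by
  intro v w hvw
  obtain ⟨C, hvC, hC⟩ := Finite.exists_le_maximal (p := fun C : Set U => G.IsClique C) (a := {v})
    (SimpleGraph.isClique_singleton v)
  have hv : v ∈ C := hvC rfl
  have hmax : ∀ x, ∃ c ∈ C, ¬ G.Adj c x := by
    intro x
    by_contra! h
    have hx : x ∈ C := hC.le_of_ge (hC.prop.insert fun c hc _ => (h c hc).symm)
      (Set.subset_insert x C) (Set.mem_insert x C)
    exact G.irrefl (h x hx)
  obtain ⟨_, ⟨_, ⟨c, hc, rfl⟩, rfl⟩, hn⟩ := hg.exists_not_adj_of_maximal_clique hH hK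
    (Set.Nonempty.image f ⟨v, hv⟩) (f.isClique_image hC.prop)
    (hf.exists_not_adj_of_maximal_clique hG hH ⟨v, hv⟩ hC.prop hmax) w
  refine ⟨c, hC.prop hc hv ?_, hn⟩
  rintro rfl
  exact hn hvw.symm
end

section
/- Let G be a finite cograph with at least two vertices and let v be a vertex of G. Then among the strong modules of G that contain v and have at least two vertices there is a least one M with respect to inclusion, and either v is adjacent in G to every other vertex of M, or v is adjacent to no vertex of M. -/
/-- A *module* of a simple graph: a set of vertices whose members all have the same
neighbours outside the set. -/
def IsModule {V : Type*} (G : SimpleGraph V) (M : Set V) : Prop :=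
  ∀ v ∈ M, ∀ w ∈ M, ∀ u ∉ M, (G.Adj v u ↔ G.Adj w u)

/-- A module is *strong* if it overlaps no other module: every module is disjoint from it,
contained in it, or contains it. -/
def IsStrongModule {V : Type*} (G : SimpleGraph V) (M : Set V) : Prop :=
  IsModule G M ∧ ∀ M' : Set V, IsModule G M' → M' ∩ M = ∅ ∨ M' ⊆ M ∨ M ⊆ M'

/-- The connected component of `v` in the subgraph of `G` induced on `A`. -/
def componentIn {V : Type*} (G : SimpleGraph V) (A : Set V) (v : V) : Set V :=
  {u | Relation.ReflTransGen (fun x y => x ∈ A ∧ y ∈ A ∧ G.Adj x y) v u}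

/-- The subgraph of `G` induced on `A` is disconnected: some nonempty proper subset of `A` has
no edges to the rest of `A`. -/
def IsDisconnectedOn {V : Type*} (G : SimpleGraph V) (A : Set V) : Prop :=
  ∃ B ⊆ A, B.Nonempty ∧ (A \ B).Nonempty ∧ ∀ x ∈ B, ∀ y ∈ A \ B, ¬ G.Adj x y

section

variable {V : Type*} {G : SimpleGraph V} {A : Set V} {v : V}

theorem mem_componentIn_self : v ∈ componentIn G A v := Relation.ReflTransGen.refl

theorem componentIn_subset (hv : v ∈ A) : componentIn G A v ⊆ A := by
  intro u hu
  induction hu with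
  | refl => exact hv
  | tail _ h _ => exact h.2.1

theorem mem_componentIn_of_adj (hv : v ∈ A) {x y : V} (hx : x ∈ componentIn G A v) (hy : y ∈ A)
    (h : G.Adj x y) : y ∈ componentIn G A v :=
  Relation.ReflTransGen.tail hx ⟨componentIn_subset hv hx, hy, h⟩

theorem exists_adj_mem_notMem_of_mem_componentIn {S : Set V} {y : V} (hvS : v ∈ S)
    (hy : y ∈ componentIn G A v) (hyS : y ∉ S) :
    ∃ p ∈ componentIn G A v, ∃ q ∈ componentIn G A v, p ∈ S ∧ q ∉ S ∧ G.Adj p q := by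
  induction hy with
  | refl => exact absurd hvS hyS
  | @tail b c hb hbc ih =>
    by_cases hbS : b ∈ S
    · exact ⟨b, hb, c, hb.tail hbc, hbS, hyS, hbc.2.2⟩
    · exact ih hbS

theorem IsDisconnectedOn.exists_notMem_componentIn (h : IsDisconnectedOn G A) :
    ∃ w ∈ A, w ∉ componentIn G A v := by
  obtain ⟨B, hBA, ⟨b, hb⟩, ⟨c, hc⟩, hB⟩ := h
  by_contra! hall
  by_cases hv : v ∈ B
  · obtain ⟨p, -, q, hq, hp, hqB, hpq⟩ :=
      exists_adj_mem_notMem_of_mem_componentIn hv (hall c hc.1) hc.2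
    exact hB p hp q ⟨componentIn_subset (hBA hv) hq, hqB⟩ hpq
  · by_cases hvA : v ∈ A
    · obtain ⟨p, hp, q, -, hpB, hq, hpq⟩ :=
        exists_adj_mem_notMem_of_mem_componentIn (S := Bᶜ) hv (hall b (hBA hb)) (by simpa using hb)
      exact hB q (by simpa using hq) p ⟨componentIn_subset hvA hp, hpB⟩ hpq.symm
    · rcases Relation.ReflTransGen.cases_head (hall b (hBA hb)) with h | ⟨_, h, -⟩
      · exact hvA (h ▸ hBA hb)
      · exact hvA h.1

theorem IsP4Free.compl_s8 (h : IsP4Free G) : IsP4Free Gᶜ := by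
  rintro ⟨a, b, c, d, hab, hac, had, hbc, hbd, hcd, h1, h2, h3, h4, h5, h6⟩
  simp only [SimpleGraph.compl_adj, not_and, not_not] at h1 h2 h3 h4 h5 h6
  exact h ⟨b, d, a, c, hbd, hab.symm, hbc, had.symm, hcd.symm, hac, h6 hbd, (h5 had).symm, h4 hac,
    fun e => h1.2 e.symm, h2.2, fun e => h3.2 e.symm⟩

theorem IsModule.compl_s8 {M : Set V} (h : IsModule G M) : IsModule Gᶜ M := by
  intro v hv w hw u hu
  have hvu : v ≠ u := fun e => hu (e ▸ hv)
  have hwu : w ≠ u := fun e => hu (e ▸ hw)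
  simp [SimpleGraph.compl_adj, hvu, hwu, h v hv w hw u hu]

theorem isModule_compl_iff {M : Set V} : IsModule Gᶜ M ↔ IsModule G M :=
  ⟨fun h => by simpa using h.compl_s8, IsModule.compl_s8⟩

theorem isStrongModule_compl_iff {M : Set V} : IsStrongModule Gᶜ M ↔ IsStrongModule G M := by
  simp only [IsStrongModule, isModule_compl_iff]

/-- Adding a vertex to a disconnected induced subgraph of a cograph leaves it disconnected or
makes its complement disconnected. -/
theorem IsDisconnectedOn.insert (hp4 : IsP4Free G) (h : IsDisconnectedOn G A) {x : V}
    (hx : x ∉ A) : IsDisconnectedOn G (insert x A) ∨ IsDisconnectedOn Gᶜ (insert x A) := by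
  by_contra! ⟨hG, hGc⟩
  -- a union of components of `A` has a neighbour of `x`
  have key : ∀ C ⊆ A, C.Nonempty → (∀ p ∈ C, ∀ q ∈ A \ C, ¬ G.Adj p q) → ∃ y ∈ C, G.Adj x y := by
    intro C hCA hC hcl
    by_contra! hno
    refine hG ⟨C, hCA.trans (Set.subset_insert _ _), hC,
      ⟨x, Set.mem_insert _ _, fun hxC => hx (hCA hxC)⟩, ?_⟩
    rintro p hp q ⟨rfl | hq, hqC⟩
    · exact fun e => hno p hp e.symm
    · exact hcl p hp q ⟨hq, hqC⟩
  obtain ⟨z, hz, hxz⟩ : ∃ z ∈ A, ¬ G.Adj x z := by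
    by_contra! hall
    obtain ⟨B, hBA, ⟨b, hb⟩, -⟩ := h
    refine hGc ⟨{x}, by simp, ⟨x, rfl⟩,
      ⟨b, Set.mem_insert_of_mem _ (hBA hb), fun e => hx (e ▸ hBA hb)⟩, ?_⟩
    rintro _ rfl q ⟨rfl | hq, hqx⟩
    · exact absurd rfl hqx
    · simp [SimpleGraph.compl_adj, hall q hq]
  have hcl : ∀ p ∈ componentIn G A z, ∀ q ∈ A \ componentIn G A z, ¬ G.Adj p q :=
    fun p hp q hq e => hq.2 (mem_componentIn_of_adj hz hp hq.1 e)
  obtain ⟨y, hy, hxy⟩ := key _ (componentIn_subset hz) ⟨z, mem_componentIn_self⟩ hcl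
  obtain ⟨w, ⟨hwA, hw⟩, hxw⟩ := key (A \ componentIn G A z) Set.sdiff_subset
    h.exists_notMem_componentIn
    (fun p hp q hq e => hcl q (by simpa [hq.1] using hq.2) p hp e.symm)
  obtain ⟨p, hp, q, hq, hxp, hxq, hpq⟩ :=
    exists_adj_mem_notMem_of_mem_componentIn (S := {u | ¬ G.Adj x u}) hxz hy (by simpa using hxy)
  have hxq : G.Adj x q := by simpa using hxq
  have hpA := componentIn_subset hz hp
  exact hp4 ⟨w, x, q, p, hxw.ne', fun e => hw (e ▸ hq), fun e => hw (e ▸ hp), hxq.ne,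
    fun e => hx (e ▸ hpA), hpq.ne', hxw.symm, hxq, hpq.symm,
    fun e => hcl q hq w ⟨hwA, hw⟩ e.symm, fun e => hcl p hp w ⟨hwA, hw⟩ e.symm, hxp⟩

/-- An induced subgraph of a cograph with at least two vertices is disconnected or has a
disconnected complement. -/
theorem IsP4Free.isDisconnectedOn_or_compl (hp4 : IsP4Free G) (hfin : A.Finite)
    (hA : A.Nontrivial) : IsDisconnectedOn G A ∨ IsDisconnectedOn Gᶜ A := by
  induction A, hfin using Set.Finite.induction_on with
  | empty => exact absurd hA Set.not_nontrivial_empty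
  | @insert x A hx _ ih =>
    rcases A.subsingleton_or_nontrivial with hs | hnt
    · obtain ⟨y, hy, hyx⟩ := hA.exists_ne x
      have hyA : y ∈ A := hy.resolve_left hyx
      have hB : ∀ H : SimpleGraph V, ¬ H.Adj x y → IsDisconnectedOn H (Insert.insert x A) := by
        intro H hH
        refine ⟨{x}, by simp, ⟨x, rfl⟩, ⟨y, hy, hyx⟩, ?_⟩
        rintro _ rfl q ⟨rfl | hq, hqx⟩
        · exact absurd rfl hqx
        · rwa [hs hq hyA]
      by_cases hadj : G.Adj x y
      · exact .inr (hB _ (by simp [SimpleGraph.compl_adj, hadj]))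
      · exact .inl (hB _ hadj)
    · rcases ih hnt with h | h
      · exact h.insert hp4 hx
      · have := h.insert hp4.compl_s8 hx
        rw [compl_compl] at this
        exact this.symm

theorem IsModule.componentIn {M : Set V} (hM : IsModule G M) (hv : v ∈ M) :
    IsModule G (componentIn G M v) := by
  intro a ha b hb u hu
  by_cases huM : u ∈ M
  · exact iff_of_false (fun e => hu (mem_componentIn_of_adj hv ha huM e))
      (fun e => hu (mem_componentIn_of_adj hv hb huM e))
  · exact hM a (componentIn_subset hv ha) b (componentIn_subset hv hb) u huM

/-- The components of a strong module are strong modules. -/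
theorem IsStrongModule.componentIn {M : Set V} (hM : IsStrongModule G M) (hv : v ∈ M) :
    IsStrongModule G (componentIn G M v) := by
  refine ⟨hM.1.componentIn hv, fun N hN => ?_⟩
  by_contra! ⟨⟨x, hxN, hx⟩, hNC, hCN⟩
  obtain ⟨w, hwN, hw⟩ := Set.not_subset.1 hNC
  obtain ⟨y, hy, hyN⟩ := Set.not_subset.1 hCN
  have hwM : w ∈ M := by
    rcases hM.2 N hN with h | h | h
    · exact absurd (h ▸ ⟨hxN, componentIn_subset hv hx⟩ : x ∈ (∅ : Set V)) (Set.notMem_empty x)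
    · exact h hwN
    · exact absurd (h (componentIn_subset hv hy)) hyN
  obtain ⟨p, hp, q, hq, hpN, hqN, hpq⟩ : ∃ p ∈ _root_.componentIn G M v,
      ∃ q ∈ _root_.componentIn G M v, p ∈ N ∧ q ∉ N ∧ G.Adj p q := by
    by_cases hvN : v ∈ N
    · exact exists_adj_mem_notMem_of_mem_componentIn hvN hy hyN
    · obtain ⟨p, hp, q, hq, hpN, hqN, hpq⟩ :=
        exists_adj_mem_notMem_of_mem_componentIn (S := Nᶜ) hvN hx (by simpa using hxN)
      exact ⟨q, hq, p, hp, by simpa using hqN, hpN, hpq.symm⟩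
  exact hw (mem_componentIn_of_adj hv hq hwM ((hN p hpN w hwN q hqN).1 hpq).symm)

theorem IsDisconnectedOn.not_adj_of_minimal {M : Set V} (h : IsDisconnectedOn G M)
    (hM : IsStrongModule G M) (hv : v ∈ M)
    (hmin : ∀ N : Set V, IsStrongModule G N → v ∈ N → N.Nontrivial → M ⊆ N) :
    ∀ u ∈ M, ¬ G.Adj v u := by
  intro u hu hvu
  obtain ⟨w, hwM, hw⟩ := h.exists_notMem_componentIn (v := v)
  exact hw (hmin _ (hM.componentIn hv) mem_componentIn_self
    ⟨v, mem_componentIn_self, u, mem_componentIn_of_adj hv mem_componentIn_self hu hvu, hvu.ne⟩ hwM)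

theorem isStrongModule_univ : IsStrongModule G Set.univ :=
  ⟨fun _ _ _ _ _ hu => absurd (Set.mem_univ _) hu, fun M' _ => .inr (.inl M'.subset_univ)⟩

theorem exists_least_nontrivial_isStrongModule [Finite V] [Nontrivial V] (G : SimpleGraph V)
    (v : V) : ∃ M : Set V, IsStrongModule G M ∧ v ∈ M ∧ M.Nontrivial ∧
      ∀ M' : Set V, IsStrongModule G M' → v ∈ M' → M'.Nontrivial → M ⊆ M' := by
  obtain ⟨M, hM⟩ := Set.Finite.exists_minimal
    (s := {M : Set V | IsStrongModule G M ∧ v ∈ M ∧ M.Nontrivial}) (Set.toFinite _)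
    ⟨Set.univ, isStrongModule_univ, Set.mem_univ v, Set.nontrivial_univ⟩
  refine ⟨M, hM.prop.1, hM.prop.2.1, hM.prop.2.2, fun M' hM' hv hnt => ?_⟩
  rcases hM.prop.1.2 M' hM'.1 with h | h | h
  · exact absurd (h ▸ ⟨hv, hM.prop.2.1⟩ : v ∈ (∅ : Set V)) (Set.notMem_empty v)
  · exact hM.le_of_le ⟨hM', hv, hnt⟩ h
  · exact h

end

/-- In a finite cograph with at least two vertices, every vertex `v` has a least strong
module `M` containing it with at least two vertices (its *scope*), and `v` is adjacent to
every other vertex of `M` or to no vertex of `M`. -/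
theorem cograph_scope_dichotomy {V : Type*} [Fintype V]
    (G : SimpleGraph V) (hp4 : IsP4Free G) (htwo : ∃ a b : V, a ≠ b) (v : V) :
    ∃ M : Set V, IsStrongModule G M ∧ v ∈ M ∧ M.Nontrivial ∧
      (∀ M' : Set V, IsStrongModule G M' → v ∈ M' → M'.Nontrivial → M ⊆ M') ∧
      ((∀ u ∈ M, u ≠ v → G.Adj v u) ∨ (∀ u ∈ M, ¬ G.Adj v u)) := by
  have : Nontrivial V := ⟨htwo⟩
  obtain ⟨M, hM, hv, hnt, hmin⟩ := exists_least_nontrivial_isStrongModule G v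
  refine ⟨M, hM, hv, hnt, hmin, ?_⟩
  rcases hp4.isDisconnectedOn_or_compl M.toFinite hnt with h | h
  · exact .inr (h.not_adj_of_minimal hM hv hmin)
  · refine .inl fun u hu huv => ?_
    have := h.not_adj_of_minimal (isStrongModule_compl_iff.2 hM) hv
      (fun N hN => hmin N (isStrongModule_compl_iff.1 hN)) u hu
    simpa [SimpleGraph.compl_adj, huv.symm] using this
end

section
/- Propositional homogeneous soundness and completeness: a simple proposition ρ is valid (true under every Boolean assignment) if and only if there exist a dualizing net N and a skew fibration of dualizing graphs from N to D(ρ). -/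
/-- A *simple proposition*: a propositional formula built from positive and negative
literals `p`, `p̄` (over a countable set of propositional variables, indexed by `ℕ`)
using only binary conjunction and disjunction. -/
inductive SimpleProp : Type
  | pos : ℕ → SimpleProp
  | neg : ℕ → SimpleProp
  | conj : SimpleProp → SimpleProp → SimpleProp
  | disj : SimpleProp → SimpleProp → SimpleProp

namespace SimpleProp

/-- Boolean evaluation of a simple proposition under an assignment of its variables. -/
def eval (f : ℕ → Bool) : SimpleProp → Bool
  | pos p => f p
  | neg p => !(f p)
  | conj φ ψ => φ.eval f && ψ.eval f
  | disj φ ψ => φ.eval f || ψ.eval f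

/-- The type of occurrences of literals in a simple proposition. -/
def Occ : SimpleProp → Type
  | pos _ => Unit
  | neg _ => Unit
  | conj φ ψ => Occ φ ⊕ Occ ψ
  | disj φ ψ => Occ φ ⊕ Occ ψ

/-- The literal (propositional variable together with a polarity) at an occurrence. -/
def lit : (ρ : SimpleProp) → ρ.Occ → ℕ × Bool
  | pos p => fun _ => (p, true)
  | neg p => fun _ => (p, false)
  | conj φ ψ => fun a =>
      match a with
      | Sum.inl a => φ.lit a
      | Sum.inr a => ψ.lit a
  | disj φ ψ => fun a =>
      match a with
      | Sum.inl a => φ.lit a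
      | Sum.inr a => ψ.lit a

/-- Two occurrences are related iff the smallest subformula containing both is a
conjunction. -/
def ConjRel : (ρ : SimpleProp) → ρ.Occ → ρ.Occ → Prop
  | pos _ => fun _ _ => False
  | neg _ => fun _ _ => False
  | conj φ ψ => fun a b =>
      match a, b with
      | Sum.inl a, Sum.inl b => φ.ConjRel a b
      | Sum.inr a, Sum.inr b => ψ.ConjRel a b
      | _, _ => True
  | disj φ ψ => fun a b =>
      match a, b with
      | Sum.inl a, Sum.inl b => φ.ConjRel a b
      | Sum.inr a, Sum.inr b => ψ.ConjRel a b
      | _, _ => False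

/-- Two occurrences are dual iff they are complementary literals `p` and `p̄` of the same
propositional variable. -/
def DualRel (ρ : SimpleProp) (a b : ρ.Occ) : Prop :=
  (ρ.lit a).1 = (ρ.lit b).1 ∧ (ρ.lit a).2 ≠ (ρ.lit b).2

/-- The graph of the dualizing graph `D(ρ)`: occurrences of literals, with edges between
occurrences whose smallest common subformula is a conjunction. -/
def egraph (ρ : SimpleProp) : SimpleGraph ρ.Occ :=
  SimpleGraph.fromRel ρ.ConjRel

/-- The duality graph of the dualizing graph `D(ρ)`: occurrences of literals, with edges
between occurrences of complementary literals. -/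
def dgraph (ρ : SimpleProp) : SimpleGraph ρ.Occ :=
  SimpleGraph.fromRel ρ.DualRel

end SimpleProp

/-- A simple graph is triangle-free if no three vertices are pairwise adjacent. -/
def IsTriangleFree {V : Type*} (G : SimpleGraph V) : Prop :=
  ¬ ∃ a b c : V, G.Adj a b ∧ G.Adj a c ∧ G.Adj b c

/-- A *dualizing graph*: a finite nonempty vertex set with a `P4`-free graph of ordinary
edges and a `P4`-free triangle-free graph of dualities. -/
structure DualizingGraph : Type 1 where
  V : Type
  [fintypeV : Fintype V]
  [nonemptyV : Nonempty V]
  E : SimpleGraph V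
  D : SimpleGraph V
  E_p4free : IsP4Free E
  D_p4free : IsP4Free D
  D_triangleFree : IsTriangleFree D

/-- A simple graph is a *matching* if every vertex is in exactly one edge. -/
def IsMatchingGraph {V : Type*} (G : SimpleGraph V) : Prop :=
  ∀ v : V, ∃! w : V, G.Adj v w

/-- A set `W` of vertices *induces a matching* in a graph `G` if `W` is nonempty and
every vertex of `W` is adjacent to exactly one vertex of `W`. -/
def InducesMatching {V : Type*} (G : SimpleGraph V) (W : Set V) : Prop :=
  W.Nonempty ∧ ∀ v ∈ W, ∃! w : V, w ∈ W ∧ G.Adj v w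

/-- A *dualizing net*: a dualizing graph whose duality graph is a matching and which has
no set of vertices inducing a matching in both the edge graph and the duality graph. -/
def DualizingGraph.IsNet (Δ : DualizingGraph) : Prop :=
  IsMatchingGraph Δ.D ∧
    ¬ ∃ W : Set Δ.V, InducesMatching Δ.E W ∧ InducesMatching Δ.D W

namespace SimpleProp

theorem conjRel_symm : ∀ (ρ : SimpleProp) (a b : ρ.Occ), ρ.ConjRel a b → ρ.ConjRel b a
  | pos _, _, _, h => h
  | neg _, _, _, h => h
  | conj φ _, Sum.inl a, Sum.inl b, h => φ.conjRel_symm a b h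
  | conj _ ψ, Sum.inr a, Sum.inr b, h => ψ.conjRel_symm a b h
  | conj _ _, Sum.inl _, Sum.inr _, _ => trivial
  | conj _ _, Sum.inr _, Sum.inl _, _ => trivial
  | disj φ _, Sum.inl a, Sum.inl b, h => φ.conjRel_symm a b h
  | disj _ ψ, Sum.inr a, Sum.inr b, h => ψ.conjRel_symm a b h
  | disj _ _, Sum.inl _, Sum.inr _, h => h
  | disj _ _, Sum.inr _, Sum.inl _, h => h

theorem conjRel_irrefl : ∀ (ρ : SimpleProp) (a : ρ.Occ), ¬ ρ.ConjRel a a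
  | pos _, _, h => h
  | neg _, _, h => h
  | conj φ _, Sum.inl a, h => φ.conjRel_irrefl a h
  | conj _ ψ, Sum.inr a, h => ψ.conjRel_irrefl a h
  | disj φ _, Sum.inl a, h => φ.conjRel_irrefl a h
  | disj _ ψ, Sum.inr a, h => ψ.conjRel_irrefl a h

theorem egraph_adj (ρ : SimpleProp) (a b : ρ.Occ) : ρ.egraph.Adj a b ↔ ρ.ConjRel a b := by
  refine ⟨fun h => h.2.elim id (ρ.conjRel_symm b a), fun h => ⟨?_, Or.inl h⟩⟩
  rintro rfl
  exact ρ.conjRel_irrefl a h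

theorem dgraph_adj (ρ : SimpleProp) (a b : ρ.Occ) : ρ.dgraph.Adj a b ↔ ρ.DualRel a b := by
  refine ⟨fun h => h.2.elim id fun h => ⟨h.1.symm, h.2.symm⟩, fun h => ⟨?_, Or.inl h⟩⟩
  rintro rfl
  exact h.2 rfl

section Adj

variable (φ ψ : SimpleProp) (a a' : φ.Occ) (b b' : ψ.Occ)

theorem conj_adj_inl_inl : (conj φ ψ).egraph.Adj (Sum.inl a) (Sum.inl a') ↔ φ.egraph.Adj a a' :=
  (egraph_adj _ _ _).trans (φ.egraph_adj a a').symm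

theorem conj_adj_inr_inr : (conj φ ψ).egraph.Adj (Sum.inr b) (Sum.inr b') ↔ ψ.egraph.Adj b b' :=
  (egraph_adj _ _ _).trans (ψ.egraph_adj b b').symm

theorem conj_adj_inl_inr : (conj φ ψ).egraph.Adj (Sum.inl a) (Sum.inr b) :=
  (egraph_adj (conj φ ψ) _ _).2 trivial

theorem disj_adj_inl_inl : (disj φ ψ).egraph.Adj (Sum.inl a) (Sum.inl a') ↔ φ.egraph.Adj a a' :=
  (egraph_adj _ _ _).trans (φ.egraph_adj a a').symm

theorem disj_adj_inr_inr : (disj φ ψ).egraph.Adj (Sum.inr b) (Sum.inr b') ↔ ψ.egraph.Adj b b' :=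
  (egraph_adj _ _ _).trans (ψ.egraph_adj b b').symm

theorem disj_not_adj_inl_inr : ¬ (disj φ ψ).egraph.Adj (Sum.inl a) (Sum.inr b) :=
  (egraph_adj (disj φ ψ) _ _).1

end Adj

theorem egraph_isP4Free (ρ : SimpleProp) : IsP4Free ρ.egraph := by
  induction ρ with
  | pos p =>
    rintro ⟨a, b, c, d, hab, -⟩
    exact hab rfl
  | neg p =>
    rintro ⟨a, b, c, d, hab, -⟩
    exact hab rfl
  | conj φ ψ ihφ ihψ =>
    have hlr := conj_adj_inl_inr φ ψ
    have hrl := fun b a => (conj_adj_inl_inr φ ψ a b).symm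
    rintro ⟨a, b, c, d, hab, hac, had, hbc, hbd, hcd, eab, ebc, ecd, nac, nad, nbd⟩
    rcases a with a | a <;> rcases c with c | c <;> rcases d with d | d <;>
      rcases b with b | b <;> first
      | exact nac (hlr _ _)
      | exact nac (hrl _ _)
      | exact nad (hlr _ _)
      | exact nad (hrl _ _)
      | exact nbd (hlr _ _)
      | exact nbd (hrl _ _)
      | skip
    · simp only [conj_adj_inl_inl] at *
      exact ihφ ⟨a, b, c, d, fun h => hab (h ▸ rfl), fun h => hac (h ▸ rfl),
        fun h => had (h ▸ rfl), fun h => hbc (h ▸ rfl), fun h => hbd (h ▸ rfl),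
        fun h => hcd (h ▸ rfl), eab, ebc, ecd, nac, nad, nbd⟩
    · simp only [conj_adj_inr_inr] at *
      exact ihψ ⟨a, b, c, d, fun h => hab (h ▸ rfl), fun h => hac (h ▸ rfl),
        fun h => had (h ▸ rfl), fun h => hbc (h ▸ rfl), fun h => hbd (h ▸ rfl),
        fun h => hcd (h ▸ rfl), eab, ebc, ecd, nac, nad, nbd⟩
  | disj φ ψ ihφ ihψ =>
    have hlr := disj_not_adj_inl_inr φ ψ
    have hrl := fun b a h => disj_not_adj_inl_inr φ ψ a b (SimpleGraph.Adj.symm h)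
    rintro ⟨a, b, c, d, hab, hac, had, hbc, hbd, hcd, eab, ebc, ecd, nac, nad, nbd⟩
    rcases a with a | a <;> rcases b with b | b <;> rcases c with c | c <;>
      rcases d with d | d <;> first
      | exact hlr _ _ eab
      | exact hrl _ _ eab
      | exact hlr _ _ ebc
      | exact hrl _ _ ebc
      | exact hlr _ _ ecd
      | exact hrl _ _ ecd
      | skip
    · simp only [disj_adj_inl_inl] at *
      exact ihφ ⟨a, b, c, d, fun h => hab (h ▸ rfl), fun h => hac (h ▸ rfl),
        fun h => had (h ▸ rfl), fun h => hbc (h ▸ rfl), fun h => hbd (h ▸ rfl),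
        fun h => hcd (h ▸ rfl), eab, ebc, ecd, nac, nad, nbd⟩
    · simp only [disj_adj_inr_inr] at *
      exact ihψ ⟨a, b, c, d, fun h => hab (h ▸ rfl), fun h => hac (h ▸ rfl),
        fun h => had (h ▸ rfl), fun h => hbc (h ▸ rfl), fun h => hbd (h ▸ rfl),
        fun h => hcd (h ▸ rfl), eab, ebc, ecd, nac, nad, nbd⟩

/-- The clauses of the conjunctive normal form of `ρ`, as sets of occurrences. These are the
maximal stable sets of `ρ.egraph`. -/
def clauses : (ρ : SimpleProp) → Set (Set ρ.Occ)
  | pos _ => {Set.univ}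
  | neg _ => {Set.univ}
  | conj φ ψ => (fun s => Sum.inl '' s) '' φ.clauses ∪ (fun s => Sum.inr '' s) '' ψ.clauses
  | disj φ ψ => Set.image2 (fun s t => Sum.inl '' s ∪ Sum.inr '' t) φ.clauses ψ.clauses

/-- The truth value of the literal at an occurrence. -/
def litEval (f : ℕ → Bool) (ρ : SimpleProp) (a : ρ.Occ) : Bool :=
  f (ρ.lit a).1 == (ρ.lit a).2

theorem eval_eq_false_iff (f : ℕ → Bool) (ρ : SimpleProp) :
    ρ.eval f = false ↔ ∃ c ∈ ρ.clauses, ∀ a ∈ c, litEval f ρ a = false := by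
  induction ρ with
  | pos p =>
    refine ⟨fun h => ⟨Set.univ, rfl, fun a _ => ?_⟩, ?_⟩
    · simpa [litEval, lit, eval] using h
    · rintro ⟨_, rfl, h⟩
      simpa [litEval, lit, eval] using h () trivial
  | neg p =>
    refine ⟨fun h => ⟨Set.univ, rfl, fun a _ => ?_⟩, ?_⟩
    · simpa [litEval, lit, eval] using h
    · rintro ⟨_, rfl, h⟩
      simpa [litEval, lit, eval] using h () trivial
  | conj φ ψ ihφ ihψ =>
    rw [eval, Bool.and_eq_false_iff, ihφ, ihψ]
    constructor
    · rintro (⟨c, hc, h⟩ | ⟨c, hc, h⟩)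
      · refine ⟨_, Or.inl ⟨c, hc, rfl⟩, ?_⟩
        rintro _ ⟨a, ha, rfl⟩
        exact h a ha
      · refine ⟨_, Or.inr ⟨c, hc, rfl⟩, ?_⟩
        rintro _ ⟨a, ha, rfl⟩
        exact h a ha
    · rintro ⟨_, ⟨c, hc, rfl⟩ | ⟨c, hc, rfl⟩, h⟩
      · exact Or.inl ⟨c, hc, fun a ha => h _ ⟨a, ha, rfl⟩⟩
      · exact Or.inr ⟨c, hc, fun a ha => h _ ⟨a, ha, rfl⟩⟩
  | disj φ ψ ihφ ihψ =>
    rw [eval, Bool.or_eq_false_iff, ihφ, ihψ]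
    constructor
    · rintro ⟨⟨c, hc, h⟩, ⟨c', hc', h'⟩⟩
      refine ⟨_, ⟨c, hc, c', hc', rfl⟩, ?_⟩
      rintro _ (⟨a, ha, rfl⟩ | ⟨a, ha, rfl⟩)
      · exact h a ha
      · exact h' a ha
    · rintro ⟨_, ⟨c, hc, c', hc', rfl⟩, h⟩
      exact ⟨⟨c, hc, fun a ha => h _ (Or.inl ⟨a, ha, rfl⟩)⟩,
        ⟨c', hc', fun a ha => h _ (Or.inr ⟨a, ha, rfl⟩)⟩⟩

theorem clauses_nonempty {ρ : SimpleProp} {c : Set ρ.Occ} (hc : c ∈ ρ.clauses) : c.Nonempty := by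
  induction ρ with
  | pos p => obtain rfl : c = Set.univ := hc; exact ⟨(), trivial⟩
  | neg p => obtain rfl : c = Set.univ := hc; exact ⟨(), trivial⟩
  | conj φ ψ ihφ ihψ =>
    rcases hc with ⟨s, hs, rfl⟩ | ⟨s, hs, rfl⟩
    · exact (ihφ hs).image _
    · exact (ihψ hs).image _
  | disj φ ψ ihφ ihψ =>
    obtain ⟨s, hs, t, ht, rfl⟩ := hc
    exact ((ihφ hs).image _).inl

theorem not_adj_of_mem_clause {ρ : SimpleProp} {c : Set ρ.Occ} (hc : c ∈ ρ.clauses) {a b : ρ.Occ}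
    (ha : a ∈ c) (hb : b ∈ c) : ¬ ρ.egraph.Adj a b := by
  induction ρ with
  | pos p => rw [egraph_adj]; exact id
  | neg p => rw [egraph_adj]; exact id
  | conj φ ψ ihφ ihψ =>
    rcases hc with ⟨s, hs, rfl⟩ | ⟨s, hs, rfl⟩
    · obtain ⟨a, ha, rfl⟩ := ha
      obtain ⟨b, hb, rfl⟩ := hb
      rw [conj_adj_inl_inl]
      exact ihφ hs ha hb
    · obtain ⟨a, ha, rfl⟩ := ha
      obtain ⟨b, hb, rfl⟩ := hb
      rw [conj_adj_inr_inr]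
      exact ihψ hs ha hb
  | disj φ ψ ihφ ihψ =>
    obtain ⟨s, hs, t, ht, rfl⟩ := hc
    rcases ha with ⟨a, ha, rfl⟩ | ⟨a, ha, rfl⟩ <;> rcases hb with ⟨b, hb, rfl⟩ | ⟨b, hb, rfl⟩
    · rw [disj_adj_inl_inl]
      exact ihφ hs ha hb
    · exact disj_not_adj_inl_inr _ _ _ _
    · exact fun h => disj_not_adj_inl_inr _ _ _ _ h.symm
    · rw [disj_adj_inr_inr]
      exact ihψ ht ha hb

theorem exists_adj_of_notMem_clause {ρ : SimpleProp} {c : Set ρ.Occ} (hc : c ∈ ρ.clauses)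
    {a : ρ.Occ} (ha : a ∉ c) : ∃ b ∈ c, ρ.egraph.Adj a b := by
  induction ρ with
  | pos p => obtain rfl : c = Set.univ := hc; exact absurd trivial ha
  | neg p => obtain rfl : c = Set.univ := hc; exact absurd trivial ha
  | conj φ ψ ihφ ihψ =>
    rcases hc with ⟨s, hs, rfl⟩ | ⟨s, hs, rfl⟩
    · rcases a with a | a
      · obtain ⟨b, hb, h⟩ := ihφ hs (a := a) fun h => ha ⟨a, h, rfl⟩
        exact ⟨_, ⟨b, hb, rfl⟩, (conj_adj_inl_inl _ _ _ _).2 h⟩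
      · obtain ⟨b, hb⟩ := clauses_nonempty hs
        exact ⟨_, ⟨b, hb, rfl⟩, (conj_adj_inl_inr _ _ _ _).symm⟩
    · rcases a with a | a
      · obtain ⟨b, hb⟩ := clauses_nonempty hs
        exact ⟨_, ⟨b, hb, rfl⟩, conj_adj_inl_inr _ _ _ _⟩
      · obtain ⟨b, hb, h⟩ := ihψ hs (a := a) fun h => ha ⟨a, h, rfl⟩
        exact ⟨_, ⟨b, hb, rfl⟩, (conj_adj_inr_inr _ _ _ _).2 h⟩
  | disj φ ψ ihφ ihψ =>
    obtain ⟨s, hs, t, ht, rfl⟩ := hc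
    rcases a with a | a
    · obtain ⟨b, hb, h⟩ := ihφ hs (a := a) fun h => ha (Or.inl ⟨a, h, rfl⟩)
      exact ⟨_, Or.inl ⟨b, hb, rfl⟩, (disj_adj_inl_inl _ _ _ _).2 h⟩
    · obtain ⟨b, hb, h⟩ := ihψ ht (a := a) fun h => ha (Or.inr ⟨a, h, rfl⟩)
      exact ⟨_, Or.inr ⟨b, hb, rfl⟩, (disj_adj_inr_inr _ _ _ _).2 h⟩

/-- Falsifying every literal of a valid proposition's clause is impossible, so each clause
contains a dual pair. -/
theorem exists_dgraph_adj_of_mem_clauses {ρ : SimpleProp} (hρ : ∀ f, ρ.eval f = true)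
    {c : Set ρ.Occ} (hc : c ∈ ρ.clauses) : ∃ a ∈ c, ∃ b ∈ c, ρ.dgraph.Adj a b := by
  classical
  by_contra! hno
  let f : ℕ → Bool := fun p => decide (∃ a ∈ c, ρ.lit a = (p, false))
  have hf : ρ.eval f = false := by
    refine (eval_eq_false_iff f ρ).2 ⟨c, hc, fun a ha => ?_⟩
    rcases hl : ρ.lit a with ⟨p, _ | _⟩
    · have : f p = true := decide_eq_true ⟨a, ha, hl⟩
      simp [litEval, hl, this]
    · have : f p = false := by
        refine decide_eq_false ?_
        rintro ⟨b, hb, hlb⟩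
        exact hno a ha b hb ((ρ.dgraph_adj a b).2 (by simp [DualRel, hl, hlb]))
      simp [litEval, hl, this]
  simp [hρ f] at hf

end SimpleProp

/-- A skew fibration between `P4`-free graphs pulls maximal stable sets back to maximal stable
sets. -/
theorem exists_adj_of_skewFibration {V X : Type*} [Finite V] {G : SimpleGraph V} {H : SimpleGraph X}
    (hG : IsP4Free G) (hH : IsP4Free H) (f : V → X) (hom : ∀ a b, G.Adj a b → H.Adj (f a) (f b))
    (skew : ∀ v w, H.Adj w (f v) → ∃ w', G.Adj w' v ∧ ¬ H.Adj (f w') w) {S : Set X}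
    (stable : ∀ a ∈ S, ∀ b ∈ S, ¬ H.Adj a b) (maximal : ∀ a ∉ S, ∃ b ∈ S, H.Adj a b)
    (v : V) (hv : f v ∉ S) : ∃ u, f u ∈ S ∧ G.Adj v u := by
  by_contra! hbad
  -- the vertices at which the claim fails
  let bad : Set V := {v | f v ∉ S ∧ ∀ u, f u ∈ S → ¬ G.Adj v u}
  obtain ⟨v, ⟨hv, hvn⟩, hmin⟩ := (Set.toFinite bad).exists_minimalFor
    (fun v => {w | w ∈ S ∧ H.Adj (f v) w}) bad ⟨v, hv, hbad⟩
  let cand : Set V := {x | G.Adj x v ∧ ∃ w ∈ S, H.Adj (f v) w ∧ ¬ H.Adj (f x) w}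
  have hcand : cand.Nonempty := by
    obtain ⟨w, hw, hvw⟩ := maximal _ hv
    obtain ⟨x, hxv, hxw⟩ := skew v w hvw.symm
    exact ⟨x, hxv, w, hw, hvw, hxw⟩
  obtain ⟨x, ⟨hxv, w, hw, hvw, hxw⟩, hxmin⟩ := (Set.toFinite cand).exists_minimalFor
    (fun x => {s | f s ∈ S ∧ G.Adj x s}) cand hcand
  have hxS : f x ∉ S := fun h => hvn x h hxv.symm
  by_cases hx : ∀ u, f u ∈ S → ¬ G.Adj x u
  · -- `x` is a counterexample with fewer neighbours of its image in `S`
    have hsub : {w | w ∈ S ∧ H.Adj (f x) w} ⊆ {w | w ∈ S ∧ H.Adj (f v) w} := by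
      rintro u ⟨hu, hxu⟩
      refine ⟨hu, ?_⟩
      by_contra hvu
      exact hH ⟨w, f v, f x, u, hvw.symm.ne, by rintro rfl; exact hxS hw,
        by rintro rfl; exact hvu hvw, (hom _ _ hxv).symm.ne, by rintro h; exact hv (h ▸ hu),
        hxu.ne, hvw.symm, (hom _ _ hxv).symm, hxu, fun h => hxw h.symm, stable _ hw _ hu, hvu⟩
    exact hxw (hmin ⟨hxS, hx⟩ hsub ⟨hw, hvw⟩).2
  · push Not at hx
    obtain ⟨s, hs, hxs⟩ := hx
    have hvs : H.Adj (f v) (f s) := by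
      by_contra hvs
      exact hH ⟨w, f v, f x, f s, hvw.symm.ne, by rintro rfl; exact hxS hw,
        fun h => hvs (h ▸ hvw), (hom _ _ hxv).symm.ne, by rintro h; exact hv (h ▸ hs),
        (hom _ _ hxs).ne, hvw.symm, (hom _ _ hxv).symm, hom _ _ hxs, fun h => hxw h.symm,
        stable _ hw _ hs, hvs⟩
    obtain ⟨y, hyv, hys⟩ := skew v (f s) hvs.symm
    have hys' : ¬ G.Adj y s := fun h => hys (hom _ _ h)
    have hyS : f y ∉ S := fun h => hvn y h hyv.symm
    have hxy : G.Adj x y := by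
      by_contra hxy
      exact hG ⟨s, x, v, y, hxs.symm.ne, by rintro rfl; exact hv hs, by rintro rfl; exact hyS hs,
        hxv.ne, by rintro rfl; exact hys' hxs, hyv.symm.ne, hxs.symm, hxv, hyv.symm,
        fun h => hvn s hs h.symm, fun h => hys' h.symm, hxy⟩
    have hsub : {t | f t ∈ S ∧ G.Adj y t} ⊆ {t | f t ∈ S ∧ G.Adj x t} := by
      rintro t ⟨ht, hyt⟩
      refine ⟨ht, ?_⟩
      by_contra hxt
      exact hG ⟨s, x, y, t, hxs.symm.ne, by rintro rfl; exact hyS hs,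
        by rintro rfl; exact hxt hxs, hxy.ne, by rintro rfl; exact hxS ht, hyt.ne, hxs.symm, hxy,
        hyt, fun h => hys' h.symm, fun h => stable _ hs _ ht (hom _ _ h), hxt⟩
    exact hys' (hxmin ⟨hyv, f s, hs, hvs, hys⟩ hsub ⟨hs, hxs⟩).2

/-- A finite nonempty set in which every element has a successor contains a nonempty subset on
which the successor relation is the graph of a bijection. -/
theorem exists_subset_bijective_rel {V : Type*} [Finite V] (r : V → V → Prop) {T : Set V}
    (hT : T.Nonempty) (hr : ∀ t ∈ T, ∃ u ∈ T, r t u) :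
    ∃ X ⊆ T, X.Nonempty ∧ (∀ t ∈ X, ∃! u, u ∈ X ∧ r t u) ∧ ∀ u ∈ X, ∃! t, t ∈ X ∧ r t u := by
  let closed : Set (Set V) := {X | X ⊆ T ∧ X.Nonempty ∧ ∀ t ∈ X, ∃ u ∈ X, r t u}
  obtain ⟨X, ⟨hXT, hX, hXr⟩, hmin⟩ := (Set.toFinite closed).exists_minimalFor id closed
    ⟨T, subset_rfl, hT, hr⟩
  have surj : ∀ g : X → X, (∀ t : X, r t (g t)) → Function.Surjective g := by
    intro g hg u
    have hsub : Subtype.val '' Set.range g ⊆ X := Subtype.coe_image_subset _ _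
    have hu := hmin (j := Subtype.val '' Set.range g) ⟨hsub.trans hXT, by
      obtain ⟨x, hx⟩ := hX
      exact ⟨_, _, ⟨⟨x, hx⟩, rfl⟩, rfl⟩, by
      rintro _ ⟨_, ⟨t, rfl⟩, rfl⟩
      exact ⟨_, ⟨_, ⟨g t, rfl⟩, rfl⟩, hg _⟩⟩ hsub u.2
    obtain ⟨_, ⟨t, rfl⟩, ht⟩ := hu
    exact ⟨t, Subtype.ext ht⟩
  choose g' hg'X hg' using hXr
  let g : X → X := fun t => ⟨g' t t.2, hg'X t t.2⟩
  have hg : ∀ t : X, r t (g t) := fun t => hg' t t.2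
  have hginj : Function.Injective g := Finite.injective_iff_surjective.2 (surj g hg)
  have huniq : ∀ t u : X, r t u → u = g t := by
    classical
    intro t u htu
    by_contra hne
    obtain ⟨s, hs⟩ := surj (Function.update g t u) (fun x => by
      by_cases hx : x = t
      · subst hx; simpa using htu
      · simpa [hx] using hg x) (g t)
    by_cases hst : s = t
    · subst hst
      exact hne (by simpa using hs)
    · rw [Function.update_of_ne hst] at hs
      exact hst (hginj hs)
  refine ⟨X, hXT, hX, fun t ht => ⟨g ⟨t, ht⟩, ⟨(g ⟨t, ht⟩).2, hg ⟨t, ht⟩⟩, ?_⟩, fun u hu => ?_⟩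
  · rintro u ⟨hu, htu⟩
    exact congrArg Subtype.val (huniq ⟨t, ht⟩ ⟨u, hu⟩ htu)
  · obtain ⟨t, ht⟩ := surj g hg ⟨u, hu⟩
    refine ⟨t, ⟨t.2, ?_⟩, ?_⟩
    · simpa [ht] using hg t
    · rintro s ⟨hs, hsu⟩
      exact congrArg Subtype.val (hginj ((huniq ⟨s, hs⟩ ⟨u, hu⟩ hsu).symm.trans ht.symm))

/-- In a dualizing net, every maximal stable set contains a duality. -/
theorem DualizingGraph.IsNet.exists_duality {Δ : DualizingGraph} (hΔ : Δ.IsNet) {T : Set Δ.V}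
    (hT : T.Nonempty) (stable : ∀ a ∈ T, ∀ b ∈ T, ¬ Δ.E.Adj a b)
    (maximal : ∀ a ∉ T, ∃ b ∈ T, Δ.E.Adj a b) : ∃ a ∈ T, ∃ b ∈ T, Δ.D.Adj a b := by
  have := Δ.fintypeV
  by_contra! hno
  obtain ⟨hD, hW⟩ := hΔ
  choose p hp hpu using hD
  have hpp : ∀ t, p (p t) = t := fun t => (hpu (p t) t (hp t).symm).symm
  have hpinj : Function.Injective p := Function.LeftInverse.injective hpp
  obtain ⟨X, hXT, hX, hout, hin⟩ := exists_subset_bijective_rel (fun t u => Δ.E.Adj (p t) u) hT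
    fun t ht => maximal _ fun h => hno t ht _ h (hp t)
  have hpX : ∀ t ∈ X, p t ∉ X := fun t ht h => hno t (hXT ht) _ (hXT h) (hp t)
  have hdual : ∀ t ∈ X, ∀ s ∈ X, ¬ Δ.E.Adj (p t) (p s) := by
    intro t ht s hs hts
    obtain ⟨u, ⟨hu, htu⟩, hu'⟩ := hout t ht
    obtain ⟨w, ⟨hw, hsw⟩, hw'⟩ := hout s hs
    have hne : u ≠ w := by
      rintro rfl
      exact hts.ne (congrArg p ((hin u hu).unique ⟨ht, htu⟩ ⟨hs, hsw⟩))
    exact Δ.E_p4free ⟨u, p t, p s, w, htu.symm.ne, by rintro rfl; exact hpX s hs hu, hne, hts.ne,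
      by rintro rfl; exact hpX t ht hw, hsw.ne, htu.symm, hts, hsw,
      fun h => hne (hw' u ⟨hu, h.symm⟩), stable _ (hXT hu) _ (hXT hw),
      fun h => hne (hu' w ⟨hw, h⟩).symm⟩
  refine hW ⟨X ∪ p '' X, ⟨hX.inl, ?_⟩, hX.inl, ?_⟩
  · rintro v (hv | ⟨t, ht, rfl⟩)
    · obtain ⟨t, ⟨ht, htv⟩, hu⟩ := hin v hv
      refine ⟨p t, ⟨Or.inr ⟨t, ht, rfl⟩, htv.symm⟩, ?_⟩
      rintro w ⟨hw | ⟨s, hs, rfl⟩, hvw⟩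
      · exact absurd hvw (stable _ (hXT hv) _ (hXT hw))
      · exact congrArg p (hu s ⟨hs, hvw.symm⟩)
    · obtain ⟨u, ⟨hu, htu⟩, hu'⟩ := hout t ht
      refine ⟨u, ⟨Or.inl hu, htu⟩, ?_⟩
      rintro w ⟨hw | ⟨s, hs, rfl⟩, hvw⟩
      · exact hu' w ⟨hw, hvw⟩
      · exact absurd hvw (hdual t ht s hs)
  · intro v hv
    refine ⟨p v, ⟨?_, hp v⟩, fun w hw => hpu v w hw.2⟩
    rcases hv with hv | ⟨t, ht, rfl⟩
    · exact Or.inr ⟨v, hv, rfl⟩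
    · rw [hpp]
      exact Or.inl ht

/-- In a finite graph, a set inducing a matching has even cardinality. -/
theorem InducesMatching.even_ncard {V : Type*} [Finite V] {G : SimpleGraph V} {W : Set V}
    (h : ∀ v ∈ W, ∃! w, w ∈ W ∧ G.Adj v w) : Even W.ncard := by
  classical
  have := Fintype.ofFinite V
  choose g hg hgu using h
  have hsum : ∑ v : W, (1 : ZMod 2) = 0 := by
    refine Finset.sum_involution (fun v _ => ⟨g v v.2, (hg v v.2).1⟩) (fun _ _ => by decide)
      (fun v _ _ h => (hg v v.2).2.ne (congrArg Subtype.val h).symm) (fun _ _ => Finset.mem_univ _)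
      fun v _ => Subtype.ext ?_
    exact (hgu _ (hg v v.2).1 v ⟨v.2, (hg v v.2).2.symm⟩).symm
  rw [Set.ncard_eq_toFinset_card', Set.toFinset_card]
  rw [Finset.sum_const, Finset.card_univ, nsmul_one] at hsum
  exact (ZMod.natCast_eq_zero_iff_even).1 hsum

theorem IsMatchingGraph.isP4Free {V : Type*} {G : SimpleGraph V} (h : IsMatchingGraph G) :
    IsP4Free G := by
  rintro ⟨a, b, c, d, -, hac, -, -, -, -, hab, hbc, -⟩
  exact hac ((h b).unique hab.symm hbc)

theorem IsMatchingGraph.isTriangleFree {V : Type*} {G : SimpleGraph V} (h : IsMatchingGraph G) :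
    IsTriangleFree G := by
  rintro ⟨a, b, c, hab, hac, hbc⟩
  exact hbc.ne ((h a).unique hab hac)

/-- The union of two graphs on disjoint vertex sets, with all edges added between the vertices
satisfying `P` on the left and those satisfying `Q` on the right. -/
def partialJoin {V W : Type*} (G : SimpleGraph V) (H : SimpleGraph W) (P : V → Prop)
    (Q : W → Prop) : SimpleGraph (V ⊕ W) where
  Adj
    | Sum.inl a, Sum.inl b => G.Adj a b
    | Sum.inr a, Sum.inr b => H.Adj a b
    | Sum.inl a, Sum.inr b => P a ∧ Q b
    | Sum.inr a, Sum.inl b => P b ∧ Q a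
  symm := ⟨by rintro (a | a) (b | b) h <;> first | exact h | exact h.symm⟩
  loopless := ⟨by rintro (a | a) h; exacts [G.irrefl h, H.irrefl h]⟩

section partialJoin

variable {V W : Type*} {G : SimpleGraph V} {H : SimpleGraph W} {P : V → Prop} {Q : W → Prop}

@[simp]
theorem partialJoin_inl_inl {a b : V} :
    (partialJoin G H P Q).Adj (Sum.inl a) (Sum.inl b) ↔ G.Adj a b := Iff.rfl

@[simp]
theorem partialJoin_inr_inr {a b : W} :
    (partialJoin G H P Q).Adj (Sum.inr a) (Sum.inr b) ↔ H.Adj a b := Iff.rfl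

@[simp]
theorem partialJoin_inl_inr {a : V} {b : W} :
    (partialJoin G H P Q).Adj (Sum.inl a) (Sum.inr b) ↔ P a ∧ Q b := Iff.rfl

@[simp]
theorem partialJoin_inr_inl {a : V} {b : W} :
    (partialJoin G H P Q).Adj (Sum.inr b) (Sum.inl a) ↔ P a ∧ Q b := Iff.rfl

theorem partialJoin_isP4Free (hG : IsP4Free G) (hH : IsP4Free H)
    (hP : ∀ a b, G.Adj a b → P a → P b) (hQ : ∀ a b, H.Adj a b → Q a → Q b) :
    IsP4Free (partialJoin G H P Q) := by
  have hP' : ∀ a b, G.Adj a b → (P a ↔ P b) := fun a b h => ⟨hP a b h, hP b a h.symm⟩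
  have hQ' : ∀ a b, H.Adj a b → (Q a ↔ Q b) := fun a b h => ⟨hQ a b h, hQ b a h.symm⟩
  rintro ⟨a, b, c, d, hab, hac, had, hbc, hbd, hcd, eab, ebc, ecd, nac, nad, nbd⟩
  unfold IsP4Free at hG hH
  rcases a with a | a <;> rcases b with b | b <;> rcases c with c | c <;> rcases d with d | d <;>
    simp only [partialJoin_inl_inl, partialJoin_inr_inr, partialJoin_inl_inr, partialJoin_inr_inl,
      ne_eq, Sum.inl.injEq, Sum.inr.injEq] at * <;> grind

theorem partialJoin_isMatchingGraph (hG : IsMatchingGraph G) (hH : IsMatchingGraph H) :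
    IsMatchingGraph (partialJoin G H (fun _ => False) (fun _ => False)) := by
  rintro (v | v)
  · obtain ⟨w, hw, hu⟩ := hG v
    refine ⟨Sum.inl w, hw, ?_⟩
    rintro (x | x) hx
    · exact congrArg Sum.inl (hu x hx)
    · exact hx.1.elim
  · obtain ⟨w, hw, hu⟩ := hH v
    refine ⟨Sum.inr w, hw, ?_⟩
    rintro (x | x) hx
    · exact hx.1.elim
    · exact congrArg Sum.inr (hu x hx)

theorem inducesMatching_inl_preimage {S : Set (V ⊕ W)}
    (hS : ∀ v ∈ S, ∃! w, w ∈ S ∧ (partialJoin G H P Q).Adj v w)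
    (hcross : ∀ v w, Sum.inl v ∈ S → Sum.inr w ∈ S → ¬ (P v ∧ Q w)) :
    ∀ v ∈ Sum.inl ⁻¹' S, ∃! w, w ∈ Sum.inl ⁻¹' S ∧ G.Adj v w := by
  intro v hv
  obtain ⟨w | w, ⟨hw, hvw⟩, hu⟩ := hS _ hv
  · exact ⟨w, ⟨hw, hvw⟩, fun x hx => Sum.inl_injective (hu (Sum.inl x) hx)⟩
  · exact absurd hvw (hcross _ _ hv hw)

theorem inducesMatching_inr_preimage {S : Set (V ⊕ W)}
    (hS : ∀ v ∈ S, ∃! w, w ∈ S ∧ (partialJoin G H P Q).Adj v w)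
    (hcross : ∀ v w, Sum.inl v ∈ S → Sum.inr w ∈ S → ¬ (P v ∧ Q w)) :
    ∀ v ∈ Sum.inr ⁻¹' S, ∃! w, w ∈ Sum.inr ⁻¹' S ∧ H.Adj v w := by
  intro v hv
  obtain ⟨w | w, ⟨hw, hvw⟩, hu⟩ := hS _ hv
  · exact absurd hvw (hcross _ _ hw hv)
  · exact ⟨w, ⟨hw, hvw⟩, fun x hx => Sum.inr_injective (hu (Sum.inr x) hx)⟩

/-- If no set induces a matching in both graphs of either pair, then neither does one in the
partial join of the ordinary edges and the disjoint union of the dualities: such a set would use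
at most one edge of the join, and that by parity is impossible. -/
theorem partialJoin_no_bimatching [Finite V] {G' : SimpleGraph V} {H' : SimpleGraph W}
    (hG : ¬ ∃ S, InducesMatching G S ∧ InducesMatching G' S)
    (hH : ¬ ∃ S, InducesMatching H S ∧ InducesMatching H' S) :
    ¬ ∃ S, InducesMatching (partialJoin G H P Q) S ∧
      InducesMatching (partialJoin G' H' (fun _ => False) (fun _ => False)) S := by
  rintro ⟨S, ⟨⟨s, hs⟩, hE⟩, -, hD⟩
  have hDl := inducesMatching_inl_preimage hD (by simp)
  have hDr := inducesMatching_inr_preimage hD (by simp)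
  by_cases hcross : ∀ v w, Sum.inl v ∈ S → Sum.inr w ∈ S → ¬ (P v ∧ Q w)
  · rcases s with s | s
    · exact hG ⟨_, ⟨⟨s, hs⟩, inducesMatching_inl_preimage hE hcross⟩, ⟨s, hs⟩, hDl⟩
    · exact hH ⟨_, ⟨⟨s, hs⟩, inducesMatching_inr_preimage hE hcross⟩, ⟨s, hs⟩, hDr⟩
  · push Not at hcross
    obtain ⟨v, w, hv, hw, hPv, hQw⟩ := hcross
    have heven : Even (Sum.inl ⁻¹' S : Set V).ncard := InducesMatching.even_ncard hDl
    have heven' : Even ((Sum.inl ⁻¹' S : Set V) \ {v}).ncard := by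
      refine InducesMatching.even_ncard (G := G) ?_
      rintro x ⟨hx, hxv⟩
      obtain ⟨y | y, ⟨hy, hxy⟩, hu⟩ := hE _ hx
      · refine ⟨y, ⟨⟨hy, ?_⟩, hxy⟩, fun z hz => Sum.inl_injective (hu (Sum.inl z) ⟨hz.1.1, hz.2⟩)⟩
        rintro rfl
        have := (hE _ hv).unique ⟨hw, show (partialJoin G H P Q).Adj _ _ from ⟨hPv, hQw⟩⟩
          ⟨hx, SimpleGraph.Adj.symm hxy⟩
        cases this
      · have := (hE _ hw).unique ⟨hv, show (partialJoin G H P Q).Adj _ _ from ⟨hPv, hQw⟩⟩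
          ⟨hx, show (partialJoin G H P Q).Adj _ _ from ⟨hxy.1, hQw⟩⟩
        exact (hxv (Sum.inl_injective this).symm).elim
    have hcard := Set.ncard_sdiff_singleton_add_one (show v ∈ (Sum.inl ⁻¹' S : Set V) from hv)
    rw [← hcard] at heven
    exact (Nat.even_add_one.1 heven) heven'

end partialJoin

/-- There is a dualizing net with a skew fibration to the subgraph induced by `U` of the dualizing
graph with ordinary edges `H` and dualities `K`. -/
def HasNetOver {X : Type*} (H K : SimpleGraph X) (U : Set X) : Prop :=
  ∃ (Δ : DualizingGraph) (f : Δ.V → X), Δ.IsNet ∧ (∀ v, f v ∈ U) ∧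
    (∀ a b, Δ.E.Adj a b → H.Adj (f a) (f b)) ∧
    (∀ v, ∀ w ∈ U, H.Adj w (f v) → ∃ w', Δ.E.Adj w' v ∧ ¬ H.Adj (f w') w) ∧
    (∀ a b, Δ.D.Adj a b → K.Adj (f a) (f b))

namespace HasNetOver

variable {X : Type*} {H K : SimpleGraph X}

theorem of_dual_pair {U : Set X} (hU : ∀ a ∈ U, ∀ b ∈ U, ¬ H.Adj a b) {a b : X} (ha : a ∈ U)
    (hb : b ∈ U) (hab : K.Adj a b) : HasNetOver H K U := by
  have hm : IsMatchingGraph (⊤ : SimpleGraph Bool) := fun v => ⟨!v, by simp, by simp⟩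
  refine ⟨⟨Bool, ⊥, ⊤, by simp [IsP4Free], hm.isP4Free, hm.isTriangleFree⟩,
    fun v => if v then a else b, ⟨hm, ?_⟩, ?_, ?_, ?_, ?_⟩
  · rintro ⟨S, ⟨⟨s, hs⟩, h⟩, -⟩
    obtain ⟨w, ⟨-, hw⟩, -⟩ := h s hs
    exact hw
  · rintro (_ | _) <;> simpa
  · rintro a b h
    exact h.elim
  · rintro (_ | _) w hw h
    · exact absurd h (hU _ hw _ (by simpa))
    · exact absurd h (hU _ hw _ (by simpa))
  · rintro (_ | _) (_ | _) h
    · exact (h rfl).elim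
    · simpa using hab.symm
    · simpa using hab
    · exact (h rfl).elim

theorem join {A B Y : Set X} (hAB : ∀ a ∈ A, ∀ b ∈ B, H.Adj a b)
    (hAY : ∀ a ∈ A, ∀ y ∈ Y, ¬ H.Adj a y) (hBY : ∀ b ∈ B, ∀ y ∈ Y, ¬ H.Adj b y)
    (hA : HasNetOver H K (A ∪ Y)) (hB : HasNetOver H K (B ∪ Y)) :
    HasNetOver H K (A ∪ B ∪ Y) := by
  obtain ⟨Δ₁, f₁, net₁, mem₁, hom₁, skew₁, dual₁⟩ := hA
  obtain ⟨Δ₂, f₂, net₂, mem₂, hom₂, skew₂, dual₂⟩ := hB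
  by_cases h₁ : ∃ v, f₁ v ∈ A
  swap
  · push Not at h₁
    have hY : ∀ v, f₁ v ∈ Y := fun v => (mem₁ v).resolve_left (h₁ v)
    refine ⟨Δ₁, f₁, net₁, fun v => Or.inr (hY v), hom₁, fun v w hw h => ?_, dual₁⟩
    rcases hw with (hw | hw) | hw
    · exact (hAY _ hw _ (hY v) h).elim
    · exact (hBY _ hw _ (hY v) h).elim
    · exact skew₁ v w (Or.inr hw) h
  by_cases h₂ : ∃ v, f₂ v ∈ B
  swap
  · push Not at h₂
    have hY : ∀ v, f₂ v ∈ Y := fun v => (mem₂ v).resolve_left (h₂ v)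
    refine ⟨Δ₂, f₂, net₂, fun v => Or.inr (hY v), hom₂, fun v w hw h => ?_, dual₂⟩
    rcases hw with (hw | hw) | hw
    · exact (hAY _ hw _ (hY v) h).elim
    · exact (hBY _ hw _ (hY v) h).elim
    · exact skew₂ v w (Or.inr hw) h
  have := Δ₁.fintypeV
  have := Δ₂.fintypeV
  have := Δ₁.nonemptyV
  have comp₁ : ∀ a b, Δ₁.E.Adj a b → f₁ a ∈ A → f₁ b ∈ A := fun a b h ha =>
    (mem₁ b).resolve_right fun hb => hAY _ ha _ hb (hom₁ _ _ h)
  have comp₂ : ∀ a b, Δ₂.E.Adj a b → f₂ a ∈ B → f₂ b ∈ B := fun a b h ha =>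
    (mem₂ b).resolve_right fun hb => hBY _ ha _ hb (hom₂ _ _ h)
  have avoid₁ : ∀ w ∈ A, ∃ v, f₁ v ∈ A ∧ ¬ H.Adj (f₁ v) w := by
    intro w hw
    obtain ⟨v, hv⟩ := h₁
    by_cases h : H.Adj (f₁ v) w
    · obtain ⟨u, huv, hu⟩ := skew₁ v w (Or.inl hw) h.symm
      exact ⟨u, comp₁ _ _ huv.symm hv, hu⟩
    · exact ⟨v, hv, h⟩
  have avoid₂ : ∀ w ∈ B, ∃ v, f₂ v ∈ B ∧ ¬ H.Adj (f₂ v) w := by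
    intro w hw
    obtain ⟨v, hv⟩ := h₂
    by_cases h : H.Adj (f₂ v) w
    · obtain ⟨u, huv, hu⟩ := skew₂ v w (Or.inl hw) h.symm
      exact ⟨u, comp₂ _ _ huv.symm hv, hu⟩
    · exact ⟨v, hv, h⟩
  have hm := partialJoin_isMatchingGraph net₁.1 net₂.1
  refine ⟨⟨Δ₁.V ⊕ Δ₂.V, partialJoin Δ₁.E Δ₂.E (fun v => f₁ v ∈ A) (fun v => f₂ v ∈ B),
    partialJoin Δ₁.D Δ₂.D (fun _ => False) (fun _ => False),
    partialJoin_isP4Free Δ₁.E_p4free Δ₂.E_p4free comp₁ comp₂, hm.isP4Free, hm.isTriangleFree⟩,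
    Sum.elim f₁ f₂, ⟨hm, partialJoin_no_bimatching net₁.2 net₂.2⟩, ?_, ?_, ?_, ?_⟩
  · rintro (v | v)
    · exact (mem₁ v).imp_left Or.inl
    · exact (mem₂ v).imp_left Or.inr
  · rintro (a | a) (b | b) h
    · exact hom₁ a b h
    · exact hAB _ h.1 _ h.2
    · exact (hAB _ h.1 _ h.2).symm
    · exact hom₂ a b h
  · rintro (v | v) w hw hwv
    · by_cases hwB : w ∈ B
      · obtain ⟨u, hu, huw⟩ := avoid₂ w hwB
        have hv : f₁ v ∈ A := (mem₁ v).resolve_right fun h => hBY _ hwB _ h hwv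
        exact ⟨Sum.inr u, ⟨hv, hu⟩, huw⟩
      · obtain ⟨u, hu, huw⟩ := skew₁ v w (hw.imp_left fun h => h.resolve_right hwB) hwv
        exact ⟨Sum.inl u, hu, huw⟩
    · by_cases hwA : w ∈ A
      · obtain ⟨u, hu, huw⟩ := avoid₁ w hwA
        have hv : f₂ v ∈ B := (mem₂ v).resolve_right fun h => hAY _ hwA _ h hwv
        exact ⟨Sum.inl u, ⟨hu, hv⟩, huw⟩
      · obtain ⟨u, hu, huw⟩ := skew₂ v w (hw.imp_left fun h => h.resolve_left hwA) hwv
        exact ⟨Sum.inr u, hu, huw⟩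
  · rintro (a | a) (b | b) h
    · exact dual₁ a b h
    · exact h.1.elim
    · exact h.1.elim
    · exact dual₂ a b h

/-- A net over an embedded proposition, in a context `Y` not joined to it, is assembled from nets
over its clauses in the same context. -/
theorem of_clauses (φ : SimpleProp) (e : φ.Occ → X)
    (he : ∀ a b, H.Adj (e a) (e b) ↔ φ.egraph.Adj a b) (Y : Set X)
    (hY : ∀ a, ∀ y ∈ Y, ¬ H.Adj (e a) y) (h : ∀ c ∈ φ.clauses, HasNetOver H K (e '' c ∪ Y)) :
    HasNetOver H K (Set.range e ∪ Y) := by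
  induction φ generalizing Y with
  | pos p => simpa using h Set.univ rfl
  | neg p => simpa using h Set.univ rfl
  | conj φ ψ ihφ ihψ =>
    have hrange : Set.range e =
        Set.range (fun a : φ.Occ => e (Sum.inl a)) ∪ Set.range (fun b : ψ.Occ => e (Sum.inr b)) :=
      Set.ext fun x => Sum.exists
    rw [hrange]
    refine join ?_ ?_ ?_ (ihφ _ ?_ Y (fun a => hY _) ?_) (ihψ _ ?_ Y (fun a => hY _) ?_)
    · rintro _ ⟨a, rfl⟩ _ ⟨b, rfl⟩
      exact (he _ _).2 (SimpleProp.conj_adj_inl_inr _ _ _ _)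
    · rintro _ ⟨a, rfl⟩
      exact hY _
    · rintro _ ⟨a, rfl⟩
      exact hY _
    · exact fun a b => (he _ _).trans (SimpleProp.conj_adj_inl_inl _ _ _ _)
    · intro c hc
      have himage : (fun a : φ.Occ => e (Sum.inl a)) '' c = e '' (Sum.inl '' c) :=
        (Set.image_image e (Sum.inl : φ.Occ → φ.Occ ⊕ ψ.Occ) c).symm
      rw [himage]
      exact h _ (Or.inl ⟨c, hc, rfl⟩)
    · exact fun a b => (he _ _).trans (SimpleProp.conj_adj_inr_inr _ _ _ _)
    · intro c hc
      have himage : (fun b : ψ.Occ => e (Sum.inr b)) '' c = e '' (Sum.inr '' c) :=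
        (Set.image_image e (Sum.inr : ψ.Occ → φ.Occ ⊕ ψ.Occ) c).symm
      rw [himage]
      exact h _ (Or.inr ⟨c, hc, rfl⟩)
  | disj φ ψ ihφ ihψ =>
    have hrange : Set.range e =
        Set.range (fun a : φ.Occ => e (Sum.inl a)) ∪ Set.range (fun b : ψ.Occ => e (Sum.inr b)) :=
      Set.ext fun x => Sum.exists
    have hsep : ∀ (a : φ.Occ) (b : ψ.Occ), ¬ H.Adj (e (Sum.inl a)) (e (Sum.inr b)) := fun a b h =>
      SimpleProp.disj_not_adj_inl_inr _ _ _ _ ((he _ _).1 h)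
    rw [hrange, Set.union_assoc]
    refine ihφ _ (fun a b => (he _ _).trans (SimpleProp.disj_adj_inl_inl _ _ _ _)) _ ?_ ?_
    · rintro a _ (⟨b, rfl⟩ | hy)
      · exact hsep a b
      · exact hY _ _ hy
    intro c hc
    rw [Set.union_left_comm]
    refine ihψ _ (fun a b => (he _ _).trans (SimpleProp.disj_adj_inr_inr _ _ _ _)) _ ?_ ?_
    · rintro b _ (⟨a, -, rfl⟩ | hy)
      · exact fun h => hsep a b h.symm
      · exact hY _ _ hy
    intro d hd
    have himage : (fun a : φ.Occ => e (Sum.inl a)) '' c ∪ (fun b : ψ.Occ => e (Sum.inr b)) '' d =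
        e '' (Sum.inl '' c ∪ Sum.inr '' d) :=
      ((Set.image_union e _ _).trans <| congrArg₂ _
        (Set.image_image e (Sum.inl : φ.Occ → φ.Occ ⊕ ψ.Occ) c)
        (Set.image_image e (Sum.inr : ψ.Occ → φ.Occ ⊕ ψ.Occ) d)).symm
    rw [Set.union_left_comm, ← Set.union_assoc, himage]
    exact h _ ⟨c, hc, d, hd, rfl⟩

end HasNetOver

/-- **Propositional homogeneous soundness and completeness**: a simple proposition `ρ` is
valid iff there is a dualizing net `Δ` and a skew fibration of dualizing graphs from `Δ`
to `D(ρ)`: a map of vertices which is a skew fibration on the ordinary edge graphs and a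
graph homomorphism on the duality graphs. -/
theorem simpleProp_valid_iff_homogeneous_combinatorial_proof (ρ : SimpleProp) :
    (∀ f : ℕ → Bool, ρ.eval f = true) ↔
      ∃ (Δ : DualizingGraph) (f : Δ.V → ρ.Occ),
        Δ.IsNet ∧
        (∀ a b : Δ.V, Δ.E.Adj a b → ρ.egraph.Adj (f a) (f b)) ∧
        (∀ (v : Δ.V) (w : ρ.Occ), ρ.egraph.Adj w (f v) →
          ∃ w' : Δ.V, Δ.E.Adj w' v ∧ ¬ ρ.egraph.Adj (f w') w) ∧
        (∀ a b : Δ.V, Δ.D.Adj a b → ρ.dgraph.Adj (f a) (f b)) := by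
  constructor
  · intro hρ
    have h : HasNetOver ρ.egraph ρ.dgraph (Set.range id ∪ ∅) := by
      refine HasNetOver.of_clauses ρ id (fun _ _ => Iff.rfl) ∅ (fun _ _ h => h.elim) fun c hc => ?_
      rw [Set.image_id, Set.union_empty]
      obtain ⟨a, ha, b, hb, hab⟩ := SimpleProp.exists_dgraph_adj_of_mem_clauses hρ hc
      exact .of_dual_pair (fun a ha b hb => SimpleProp.not_adj_of_mem_clause hc ha hb) ha hb hab
    obtain ⟨Δ, f, net, -, hom, skew, dual⟩ := h
    exact ⟨Δ, f, net, hom, fun v w => skew v w (by simp), dual⟩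
  · rintro ⟨Δ, f, net, hom, skew, dual⟩ g
    by_contra hg
    obtain ⟨c, hc, hfalse⟩ := (SimpleProp.eval_eq_false_iff g ρ).1 (by simpa using hg)
    have := Δ.fintypeV
    have stable : ∀ a ∈ f ⁻¹' c, ∀ b ∈ f ⁻¹' c, ¬ Δ.E.Adj a b := fun a ha b hb h =>
      SimpleProp.not_adj_of_mem_clause hc ha hb (hom a b h)
    have maximal : ∀ a ∉ f ⁻¹' c, ∃ b ∈ f ⁻¹' c, Δ.E.Adj a b :=
      exists_adj_of_skewFibration Δ.E_p4free ρ.egraph_isP4Free f hom skew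
        (fun a ha b hb => SimpleProp.not_adj_of_mem_clause hc ha hb)
        (fun a ha => SimpleProp.exists_adj_of_notMem_clause hc ha)
    have hne : (f ⁻¹' c).Nonempty := by
      obtain ⟨v⟩ := Δ.nonemptyV
      by_cases hv : v ∈ f ⁻¹' c
      · exact ⟨v, hv⟩
      · exact (maximal v hv).imp fun _ h => h.1
    obtain ⟨a, ha, b, hb, hab⟩ := net.exists_duality hne stable maximal
    obtain ⟨h₁, h₂⟩ := (ρ.dgraph_adj _ _).1 (dual a b hab)
    have h₃ := hfalse _ ha
    have h₄ := hfalse _ hb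
    simp only [SimpleProp.litEval, h₁, beq_eq_false_iff_ne] at h₃ h₄
    exact h₂ (((Bool.eq_not.2 h₃.symm).trans (Bool.eq_not.2 h₄.symm).symm))
end

section
/- The map ρ ↦ D(ρ) is surjective onto dualizing graphs up to isomorphism: for every dualizing graph Δ there exists a simple proposition ρ and a bijection between the vertices of D(ρ) and the vertices of Δ that preserves and reflects both ordinary edges and dualities. -/
namespace IsP4Free

variable {V : Type*} {G : SimpleGraph V}

/-- The complement of a `P4`-free graph is `P4`-free. -/
theorem compl_s17 (hG : IsP4Free G) : IsP4Free Gᶜ := by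
  rintro ⟨a, b, c, d, hab, hac, had, hbc, hbd, hcd, h₁, h₂, h₃, h₄, h₅, h₆⟩
  simp only [SimpleGraph.compl_adj, not_and, not_not] at h₁ h₂ h₃ h₄ h₅ h₆
  exact hG ⟨c, a, d, b, hac.symm, hcd, hbc.symm, had, hab, hbd.symm, (h₄ hac).symm, h₅ had,
    (h₆ hbd).symm, h₃.2, fun h => h₂.2 h.symm, h₁.2⟩

end IsP4Free

namespace SimpleGraph

variable {V : Type*} {G : SimpleGraph V}

/-- The vertex set `S` is the union of two disjoint nonempty sets without edges of `G`
between them. -/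
def HasSplit (G : SimpleGraph V) (S : Set V) : Prop :=
  ∃ A B : Set V, A.Nonempty ∧ B.Nonempty ∧ Disjoint A B ∧ A ∪ B = S ∧
    ∀ a ∈ A, ∀ b ∈ B, ¬ G.Adj a b

theorem HasSplit.insert {S : Set V} (hG : IsP4Free G) (hS : G.HasSplit S) {v : V}
    (hv : v ∉ S) : G.HasSplit (insert v S) ∨ Gᶜ.HasSplit (insert v S) := by
  obtain ⟨A, B, hA, hB, hAB, rfl, hnadj⟩ := hS
  by_cases hall : ∀ x ∈ A ∪ B, G.Adj v x
  · refine .inr ⟨{v}, A ∪ B, Set.singleton_nonempty v, hA.inl, by simpa using hv, rfl, ?_⟩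
    rintro _ rfl b hb h
    exact h.2 (hall b hb)
  push Not at hall
  obtain ⟨x, hx, hvx⟩ := hall
  left
  wlog hxA : x ∈ A generalizing A B
  · rw [Set.union_comm] at hv hx ⊢
    exact this B A hB hA hAB.symm (fun b hb a ha h => hnadj a ha b hb h.symm) hv hx
      (hx.resolve_right hxA)
  by_cases hw : ∃ w ∈ B, G.Adj v w
  · obtain ⟨w, hwB, hvw⟩ := hw
    set R : Set V := {y | Relation.ReflTransGen (fun a b => G.Adj a b ∧ b ∈ A) x y} with hR
    have hRA : ∀ y ∈ R, y ∈ A ∧ ¬ G.Adj v y := by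
      intro y hy
      induction hy with
      | refl => exact ⟨hxA, hvx⟩
      | @tail z y _ hzy ih =>
        refine ⟨hzy.2, fun hvy => hG ⟨z, y, v, w, hzy.1.ne, ?_, ?_, hvy.ne', ?_, hvw.ne,
          hzy.1, hvy.symm, hvw, fun h => ih.2 h.symm, hnadj z ih.1 w hwB,
          hnadj y hzy.2 w hwB⟩⟩
        · rintro rfl
          exact hv (.inl ih.1)
        · exact hAB.ne_of_mem ih.1 hwB
        · exact hAB.ne_of_mem hzy.2 hwB
    refine ⟨R, Insert.insert v (A ∪ B) \ R, ⟨x, .refl⟩,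
      ⟨v, Set.mem_insert _ _, fun h => hv (.inl (hRA v h).1)⟩, Set.disjoint_sdiff_right,
      Set.union_sdiff_cancel fun y hy => .inr (.inl (hRA y hy).1), ?_⟩
    rintro a ha b ⟨rfl | hb | hb, hbR⟩ hab
    · exact (hRA a ha).2 hab.symm
    · exact hbR (Relation.ReflTransGen.tail ha ⟨hab, hb⟩)
    · exact hnadj a (hRA a ha).1 b hb hab
  · push Not at hw
    refine ⟨Insert.insert v A, B, Set.insert_nonempty v A, hB, ?_, Set.insert_union, ?_⟩
    · exact Set.disjoint_insert_left.2 ⟨fun h => hv (.inr h), hAB⟩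
    · rintro a (rfl | ha) b hb
      · exact hw b hb
      · exact hnadj a ha b hb

/-- A nontrivial finite set of vertices of a `P4`-free graph is disconnected in the graph or
in its complement. -/
theorem hasSplit_or_hasSplit_compl (hG : IsP4Free G) {S : Set V} (hfin : S.Finite)
    (hS : S.Nontrivial) : G.HasSplit S ∨ Gᶜ.HasSplit S := by
  induction S, hfin using Set.Finite.induction_on with
  | empty => simp at hS
  | @insert v S hv _ ih =>
    by_cases hnt : S.Nontrivial
    · rcases ih hnt with h | h
      · exact h.insert hG hv
      · simpa [or_comm] using h.insert hG.compl_s17 hv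
    · rcases (Set.not_nontrivial_iff.1 hnt).eq_empty_or_singleton with rfl | ⟨x, rfl⟩
      · simp at hS
      · have hvx : v ≠ x := by simpa using hv
        by_cases h : G.Adj v x
        · exact .inr ⟨{v}, {x}, by simp, by simp, by simpa using hvx, rfl, by simp [h]⟩
        · exact .inl ⟨{v}, {x}, by simp, by simp, by simpa using hvx, rfl, by simp [h]⟩

/-- In a `P4`-free and triangle-free graph the end points of a walk of length three are
adjacent. -/
theorem adj_of_adj_of_adj_of_adj (hG : IsP4Free G) (hT : IsTriangleFree G) {a b c d : V}
    (hab : G.Adj a b) (hbc : G.Adj b c) (hcd : G.Adj c d) : G.Adj a d := by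
  by_contra had
  have hac : ¬ G.Adj a c := fun h => hT ⟨a, b, c, hab, h, hbc⟩
  have hbd : ¬ G.Adj b d := fun h => hT ⟨b, c, d, hbc, h, hcd⟩
  refine hG ⟨a, b, c, d, hab.ne, ?_, ?_, hbc.ne, ?_, hcd.ne, hab, hbc, hcd, hac, had, hbd⟩
  · rintro rfl
    exact had hcd
  · rintro rfl
    exact hac hcd.symm
  · rintro rfl
    exact had hab

/-- In a `P4`-free and triangle-free graph, reachable vertices have distance at most two. -/
theorem Reachable.eq_or_adj_or_exists_adj (hG : IsP4Free G) (hT : IsTriangleFree G) {a b : V}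
    (h : G.Reachable a b) : a = b ∨ G.Adj a b ∨ ∃ m, G.Adj a m ∧ G.Adj m b := by
  obtain ⟨p⟩ := h
  induction p with
  | nil => exact .inl rfl
  | @cons u v w huv _ ih =>
    rcases ih with rfl | h | ⟨m, hvm, hmw⟩
    · exact .inr (.inl huv)
    · exact .inr (.inr ⟨v, huv, h⟩)
    · exact .inr (.inl (adj_of_adj_of_adj_of_adj hG hT huv hvm hmw))

/-- Each component of a `P4`-free and triangle-free graph is complete bipartite, so the graph
is the complementarity graph of a labelling of its vertices by literals. -/
theorem exists_literal_labelling [Finite V] (hG : IsP4Free G) (hT : IsTriangleFree G) :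
    ∃ l : V → ℕ × Bool, ∀ a b, G.Adj a b ↔ (l a).1 = (l b).1 ∧ (l a).2 ≠ (l b).2 := by
  classical
  obtain ⟨i, hi⟩ := exists_injective_nat G.ConnectedComponent
  let root (v : V) : V := (G.connectedComponentMk v).out
  have hroot (v : V) : G.Reachable (root v) v :=
    ConnectedComponent.exact (G.connectedComponentMk v).out_eq
  have hcross {r a b : V} (hra : G.Adj r a) (hrb : ¬ G.Adj r b) (h : G.Reachable r b) :
      G.Adj a b := by
    rcases h.eq_or_adj_or_exists_adj hG hT with rfl | h | ⟨m, hrm, hmb⟩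
    · exact hra.symm
    · exact absurd h hrb
    · exact adj_of_adj_of_adj_of_adj hG hT hra.symm hrm hmb
  refine ⟨fun v => (i (G.connectedComponentMk v), decide (G.Adj (root v) v)), fun a b => ?_⟩
  simp only [hi.eq_iff, ne_eq, decide_eq_decide]
  constructor
  · intro hab
    have hcomp : G.connectedComponentMk a = G.connectedComponentMk b :=
      ConnectedComponent.sound hab.reachable
    have hr : root a = root b := congrArg Quot.out hcomp
    refine ⟨hcomp, fun h => ?_⟩
    by_cases hb : G.Adj (root b) b
    · exact hT ⟨root b, a, b, hr ▸ h.2 hb, hb, hab⟩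
    · have ha : ¬ G.Adj (root b) a := fun ha => hb (h.1 (hr ▸ ha))
      rcases (hr ▸ hroot a).eq_or_adj_or_exists_adj hG hT with rfl | h | ⟨m, hrm, hma⟩
      · exact hb (by assumption)
      · exact ha h
      · exact hb (adj_of_adj_of_adj_of_adj hG hT hrm hma hab)
  · rintro ⟨hcomp, h⟩
    have hr : root a = root b := congrArg Quot.out hcomp
    rw [hr] at h
    by_cases ha : G.Adj (root b) a
    · exact hcross ha (fun hb => h (by simp [ha, hb])) (hroot b)
    · have hb : G.Adj (root b) b := by
        by_contra hb
        exact h (by simp [ha, hb])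
      exact (hcross hb ha (hr ▸ hroot a)).symm

/-- A finite nonempty set of vertices of a `P4`-free graph, labelled by literals, is realized by
a simple proposition. -/
theorem exists_simpleProp (hG : IsP4Free G) (l : V → ℕ × Bool) {S : Set V} (hfin : S.Finite)
    (hS : S.Nonempty) :
    ∃ (ρ : SimpleProp) (f : ρ.Occ → V), f.Injective ∧ Set.range f = S ∧
      (∀ a, ρ.lit a = l (f a)) ∧ ∀ a b, ρ.ConjRel a b ↔ G.Adj (f a) (f b) := by
  induction h : S.ncard using Nat.strong_induction_on generalizing S with
  | _ n ih =>
  subst h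
  by_cases hnt : S.Nontrivial
  · have hsub {H : SimpleGraph V} (h : H.HasSplit S) :
        ∃ (φ ψ : SimpleProp) (f : φ.Occ → V) (g : ψ.Occ → V),
          (Sum.elim f g).Injective ∧ Set.range (Sum.elim f g) = S ∧
          (∀ a, φ.lit a = l (f a)) ∧ (∀ a, ψ.lit a = l (g a)) ∧
          (∀ a b, φ.ConjRel a b ↔ G.Adj (f a) (f b)) ∧
          (∀ a b, ψ.ConjRel a b ↔ G.Adj (g a) (g b)) ∧
          ∀ a b, f a ≠ g b ∧ ¬ H.Adj (f a) (g b) := by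
      obtain ⟨A, B, hA, hB, hAB, rfl, hnadj⟩ := h
      obtain ⟨φ, f, hf, rfl, hlf, hcf⟩ := ih _ (Set.ncard_lt_ncard (Set.ssubset_iff_subset_ne.2
        ⟨Set.subset_union_left, fun h => hB.ne_empty
          (hAB.symm.eq_bot_of_le (Set.union_eq_left.1 h.symm))⟩) hfin) (hfin.subset Set.subset_union_left) hA rfl
      obtain ⟨ψ, g, hg, rfl, hlg, hcg⟩ := ih _ (Set.ncard_lt_ncard (Set.ssubset_iff_subset_ne.2
        ⟨Set.subset_union_right, fun h => hA.ne_empty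
          (hAB.eq_bot_of_le (Set.union_eq_right.1 h.symm))⟩) hfin) (hfin.subset Set.subset_union_right) hB rfl
      have hne (a : φ.Occ) (b : ψ.Occ) : f a ≠ g b :=
        hAB.ne_of_mem (Set.mem_range_self a) (Set.mem_range_self b)
      exact ⟨φ, ψ, f, g, hf.sumElim hg hne, Set.Sum.elim_range f g, hlf, hlg, hcf, hcg,
        fun a b => ⟨hne a b, hnadj _ (Set.mem_range_self a) _ (Set.mem_range_self b)⟩⟩
    rcases hasSplit_or_hasSplit_compl hG hfin hnt with h | h
    · obtain ⟨φ, ψ, f, g, hinj, hrange, hlf, hlg, hcf, hcg, hfg⟩ := hsub h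
      refine ⟨.disj φ ψ, Sum.elim f g, hinj, hrange, ?_, ?_⟩
      · rintro (a | a)
        · exact hlf a
        · exact hlg a
      · rintro (a | a) (b | b)
        · exact hcf a b
        · exact iff_of_false id (hfg a b).2
        · exact iff_of_false id fun h => (hfg b a).2 h.symm
        · exact hcg a b
    · obtain ⟨φ, ψ, f, g, hinj, hrange, hlf, hlg, hcf, hcg, hfg⟩ := hsub h
      have hadj (a : φ.Occ) (b : ψ.Occ) : G.Adj (f a) (g b) := by
        simpa [SimpleGraph.compl_adj, (hfg a b).1] using (hfg a b).2
      refine ⟨.conj φ ψ, Sum.elim f g, hinj, hrange, ?_, ?_⟩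
      · rintro (a | a)
        · exact hlf a
        · exact hlg a
      · rintro (a | a) (b | b)
        · exact hcf a b
        · exact iff_of_true trivial (hadj a b)
        · exact iff_of_true trivial (hadj b a).symm
        · exact hcg a b
  · obtain ⟨x, rfl⟩ := (Set.not_nontrivial_iff.1 hnt).eq_empty_or_singleton.resolve_left hS.ne_empty
    have hinj (f : Unit → V) : f.Injective := Function.injective_of_subsingleton f
    rcases h : l x with ⟨n, _ | _⟩
    · exact ⟨.neg n, fun _ => x, hinj _, Set.range_const (ι := Unit), fun _ => h.symm,
        fun _ _ => by simp [SimpleProp.ConjRel]⟩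
    · exact ⟨.pos n, fun _ => x, hinj _, Set.range_const (ι := Unit), fun _ => h.symm,
        fun _ _ => by simp [SimpleProp.ConjRel]⟩

end SimpleGraph

/-- The map `ρ ↦ D(ρ)` is surjective onto dualizing graphs up to isomorphism: every
dualizing graph `Δ` is isomorphic, via a bijection preserving and reflecting both
ordinary edges and dualities, to `D(ρ)` for some simple proposition `ρ`. -/
theorem dualizingGraph_surjective (Δ : DualizingGraph) :
    ∃ (ρ : SimpleProp) (e : ρ.Occ ≃ Δ.V),
      (∀ a b : ρ.Occ, ρ.egraph.Adj a b ↔ Δ.E.Adj (e a) (e b)) ∧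
      (∀ a b : ρ.Occ, ρ.dgraph.Adj a b ↔ Δ.D.Adj (e a) (e b)) := by
  have := Δ.fintypeV
  have := Δ.nonemptyV
  obtain ⟨l, hl⟩ := SimpleGraph.exists_literal_labelling Δ.D_p4free Δ.D_triangleFree
  obtain ⟨ρ, f, hf, hrange, hlit, hconj⟩ :=
    SimpleGraph.exists_simpleProp Δ.E_p4free l Set.finite_univ Set.univ_nonempty
  refine ⟨ρ, Equiv.ofBijective f ⟨hf, Set.range_eq_univ.1 hrange⟩, fun a b => ?_, fun a b => ?_⟩
  · simp only [SimpleProp.egraph, SimpleGraph.fromRel_adj, hconj, Δ.E.adj_comm (f b), or_self]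
    exact ⟨And.right, fun h => ⟨fun hab => h.ne (hab ▸ rfl), h⟩⟩
  · simp only [SimpleProp.dgraph, SimpleGraph.fromRel_adj, SimpleProp.DualRel, hlit, ← hl,
      Δ.D.adj_comm (f b), or_self]
    exact ⟨And.right, fun h => ⟨fun hab => h.ne (hab ▸ rfl), h⟩⟩
end
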